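/- arXiv:1604.05777 — 12 statements merged into one kernel-verified Lean document; each statement's English description precedes it below -/
import Mathlib

section
/- Let C be a linear code of length n over F_{q^r} and let F_t be a subfield of F_{q^r}. Then the dual of the subfield subcode equals the trace code of the dual: (C|F_t)^⊥ = Tr_{F_{q^r}/F_t}(C^⊥), where the dual is taken with respect to the standard bilinear form on F_t^n and F_{q^r}^n respectively. -/
open scoped BigOperators

/-- The dual code with respect to the standard bilinear form. -/
def dualCode {F : Type*} [Field F] {n : ℕ} (C : Submodule F (Fin n → F)) :
    Submodule F (Fin n → F) where
  carrier := {x | ∀ c ∈ C, ∑ i, x i * c i = 0}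
  zero_mem' := by intro c hc; simp
  add_mem' := by
    intro x y hx hy c hc
    simp [add_mul, Finset.sum_add_distrib, hx c hc, hy c hc]
  smul_mem' := by
    intro a x hx c hc
    simp [smul_eq_mul, mul_assoc, ← Finset.mul_sum, hx c hc]

/-- The trace code of a code `C ⊆ K^n`: the image of `C` under the coordinatewise
field trace, a linear code over the subfield `F`. -/
noncomputable def traceCode (F : Type*) {K : Type*} [Field F] [Field K] [Algebra F K]
    {n : ℕ} (C : Submodule K (Fin n → K)) : Submodule F (Fin n → F) :=
  (C.restrictScalars F).map
    (LinearMap.pi fun i => (Algebra.trace F K).comp (LinearMap.proj i))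

/-- The subfield subcode `C ∩ F^n` of a code `C ⊆ K^n`, viewed as a code over `F`:
its elements are the vectors `x` over `F` whose coordinatewise image in `K` lies in `C`. -/
def subfieldSubcode (F : Type*) {K : Type*} [Field F] [Field K] [Algebra F K]
    {n : ℕ} (C : Submodule K (Fin n → K)) : Submodule F (Fin n → F) :=
  (C.restrictScalars F).comap
    (LinearMap.pi fun i => (Algebra.linearMap F K).comp (LinearMap.proj i))

theorem dualCode_separates {F : Type*} [Field F] {n : ℕ} (C : Submodule F (Fin n → F))
    (x : Fin n → F) (hx : x ∉ C) : ∃ y ∈ dualCode C, ∑ i, y i * x i ≠ 0 := by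
  obtain ⟨f, hfx, hf⟩ := Submodule.exists_dual_map_eq_bot_of_notMem hx inferInstance
  have key : ∀ v : Fin n → F, ∑ i, f (Pi.single i 1) * v i = f v := by
    intro v
    conv_rhs => rw [pi_eq_sum_univ' v, map_sum]
    refine Finset.sum_congr rfl fun i _ => ?_
    rw [map_smul, smul_eq_mul, mul_comm]
  refine ⟨fun i => f (Pi.single i 1), ?_, ?_⟩
  · intro c hc
    rw [key]
    have : f c ∈ C.map f := ⟨c, hc, rfl⟩
    rwa [hf, Submodule.mem_bot] at this
  · rw [key]; exact hfx

theorem trace_pairing {F K : Type*} [Field F] [Field K] [Algebra F K] {n : ℕ}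
    (z : Fin n → K) (y : Fin n → F) :
    Algebra.trace F K (∑ i, z i * algebraMap F K (y i)) =
      ∑ i, Algebra.trace F K (z i) * y i := by
  rw [map_sum]
  refine Finset.sum_congr rfl fun i _ => ?_
  rw [mul_comm, ← Algebra.smul_def, map_smul, smul_eq_mul, mul_comm]

/-- **Delsarte's Theorem.** Let `K = F_{q^r}` and let `F = F_t` be a subfield of `K`.
For a linear code `C` of length `n` over `K`, the dual of the subfield subcode `C|F_t`
equals the trace code of the dual code: `(C|F_t)^⊥ = Tr_{K/F}(C^⊥)`. -/
theorem dual_subfieldSubcode_eq_traceCode_dual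
    (q r t : ℕ) (hq : IsPrimePow q) (ht : IsPrimePow t) (hr : 1 < r)
    (F K : Type*) [Field F] [Field K] [Fintype F] [Fintype K] [Algebra F K]
    (hK : Fintype.card K = q ^ r) (hF : Fintype.card F = t)
    (n : ℕ) (C : Submodule K (Fin n → K)) :
    dualCode (subfieldSubcode F C) = traceCode F (dualCode C) := by
  apply le_antisymm
  · intro x hx
    by_contra hn
    obtain ⟨y, hy, hyx⟩ := dualCode_separates _ x hn
    apply hyx
    have hyC : y ∈ subfieldSubcode F C := by
      by_contra hyn
      obtain ⟨z, hz, hzy⟩ := dualCode_separates C (fun i => algebraMap F K (y i)) hyn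
      apply hzy
      apply (traceForm_nondegenerate F K).1
      intro a
      rw [Algebra.traceForm_apply, mul_comm, Finset.mul_sum]
      have h1 := hy (fun i => Algebra.trace F K (a * z i))
        ⟨a • z, (dualCode C).smul_mem a hz, rfl⟩
      have h2 := trace_pairing (F := F) (fun i => a * z i) y
      simp only [mul_assoc] at h2
      rw [h2, ← h1]
      exact Finset.sum_congr rfl fun i _ => mul_comm _ _
    rw [← hx y hyC]
    exact Finset.sum_congr rfl fun i _ => mul_comm _ _
  · rintro _ ⟨z, hz, rfl⟩ c hc
    have h := trace_pairing (F := F) z c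
    have h0 : ∑ i, z i * algebraMap F K (c i) = 0 := hz _ hc
    rw [h0, map_zero] at h
    exact h.symm
end

section
/- Suppose q^r = t^m. Let C be a linear code over F_{q^r} of length n and let C^o := ∩_{i=0}^{m-1} C^{(t^i)}. Then C^o equals the F_{q^r}-linear span of the subfield subcode C|F_t inside F_{q^r}^n. -/
open scoped BigOperators

/-- `C^{(s)}`: the coordinatewise `s`-th power of a set of vectors. -/
def powSet {K : Type*} [Monoid K] {n : ℕ} (C : Set (Fin n → K)) (s : ℕ) :
    Set (Fin n → K) :=
  (fun c => fun i => c i ^ s) '' C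

/-- Suppose `q^r = t^m`, `K = F_{q^r}` and `F = F_t` is a subfield of `K`. For a linear
code `C` of length `n` over `K`, the code `C^o := ∩_{i=0}^{m-1} C^{(t^i)}` equals the
`K`-linear span of the subfield subcode `C|F_t = C ∩ F^n` inside `K^n`. -/
theorem iInter_powSet_eq_span_subfieldSubcode
    (q r t m : ℕ) (hq : IsPrimePow q) (ht : IsPrimePow t) (hr : 1 < r)
    (F K : Type*) [Field F] [Field K] [Fintype F] [Fintype K] [Algebra F K]
    (hK : Fintype.card K = q ^ r) (hF : Fintype.card F = t) (hm : q ^ r = t ^ m)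
    (n : ℕ) (C : Submodule K (Fin n → K)) :
    (⋂ i ∈ Finset.range m, powSet (C : Set (Fin n → K)) (t ^ i))
      = ↑(Submodule.span K
          {c : Fin n → K | c ∈ C ∧ ∀ j, c j ∈ Set.range (algebraMap F K)}) := by
  subst hF
  set t := Fintype.card F with htdef
  have hKm : Fintype.card K = t ^ m := hK.trans hm
  have hfin : Module.finrank F K = m := by
    have h := Module.card_eq_pow_finrank (K := F) (V := K)
    rw [hKm] at h
    exact (Nat.pow_right_injective ht.two_le h).symm
  have hid : ∀ a : K, a ^ t ^ m = a := fun a => by rw [← hKm]; exact FiniteField.pow_card a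
  have hmpos : 0 < m := hfin ▸ Module.finrank_pos
  have hadd : ∀ (k : ℕ) (a b : K), (a + b) ^ t ^ k = a ^ t ^ k + b ^ t ^ k := by
    intro k a b
    have h := FiniteField.coe_frobeniusAlgEquivOfAlgebraic_iterate F K k
    have h2 := fun x => congrFun h x
    have h3 := iterate_map_add (FiniteField.frobeniusAlgEquivOfAlgebraic F K) k a b
    rw [h2, h2, h2] at h3
    exact h3
  have hmem : ∀ i ≤ m, ∀ y : Fin n → K, y ∈ powSet (C : Set (Fin n → K)) (t ^ i) ↔
      (fun j => y j ^ t ^ (m - i)) ∈ C := by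
    intro i hi y
    constructor
    · rintro ⟨c, hc, rfl⟩
      have : (fun j => (c j ^ t ^ i) ^ t ^ (m - i)) = c := by
        funext j
        rw [← pow_mul, ← pow_add, Nat.add_sub_cancel' hi, hid]
      simp only [this]
      exact hc
    · intro h
      refine ⟨_, h, ?_⟩
      funext j
      simp only
      rw [← pow_mul, ← pow_add, Nat.sub_add_cancel hi, hid]
  ext x
  simp only [Set.mem_iInter, Finset.mem_range, SetLike.mem_coe]
  constructor
  · intro hx
    have hxk : ∀ k < m, (fun j => x j ^ t ^ k) ∈ C := by
      intro k hk
      rcases Nat.eq_zero_or_pos k with rfl | hk0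
      · have h := (hmem 0 (Nat.zero_le _) x).1 (hx 0 hmpos)
        simpa [hid] using h
      · have h := (hmem (m - k) (Nat.sub_le _ _) x).1 (hx (m - k) (by omega))
        rwa [Nat.sub_sub_self hk.le] at h
    let b := Module.finBasis F K
    have hxs : x = ∑ i, b.traceDual i • (fun j => algebraMap F K (Algebra.trace F K (x j * b i))) := by
      funext j
      conv_lhs => rw [← b.traceDual.sum_repr (x j)]
      simp [Finset.sum_apply, Algebra.smul_def, mul_comm, Algebra.traceForm_apply]
    rw [hxs]
    refine Submodule.sum_mem _ fun i _ => Submodule.smul_mem _ _ (Submodule.subset_span ⟨?_, fun j => ⟨_, rfl⟩⟩)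
    generalize b i = β
    have : (fun j => algebraMap F K (Algebra.trace F K (x j * β))) =
        ∑ k ∈ Finset.range m, (β ^ t ^ k) • (fun j => x j ^ t ^ k) := by
      funext j
      rw [FiniteField.algebraMap_trace_eq_sum_pow, hfin, Nat.card_eq_fintype_card]
      simp [Finset.sum_apply, mul_pow, mul_comm, t]
    rw [this]
    exact Submodule.sum_mem _ fun k hk => Submodule.smul_mem _ _ (hxk k (Finset.mem_range.1 hk))
  · intro hx i hi
    rw [hmem i hi.le]
    generalize m - i = k
    induction hx using Submodule.span_induction with
    | mem x h =>
      obtain ⟨hc, hr⟩ := h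
      convert hc using 1
      funext j
      obtain ⟨a, ha⟩ := hr j
      rw [← ha, ← map_pow, FiniteField.pow_card_pow]
    | zero =>
      convert C.zero_mem using 1
      funext j
      simp [ht.ne_zero]
    | add x y _ _ h1 h2 =>
      convert C.add_mem h1 h2 using 1
      funext j
      simp [hadd]
    | smul a x _ h =>
      convert C.smul_mem (a ^ t ^ k) h using 1
      funext j
      simp [mul_pow]
end

section
/- Suppose q^r = t^m. Let C be a linear code over F_{q^r} of length n and let C^∧ := Σ_{i=0}^{m-1} C^{(t^i)}. Then C^∧ equals the F_{q^r}-linear span of the trace code Tr_{F_{q^r}/F_t}(C) inside F_{q^r}^n. -/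
open scoped BigOperators

/-- Suppose `q^r = t^m`, `K = F_{q^r}` and `F = F_t` is a subfield of `K`. For a linear
code `C` of length `n` over `K`, the code `C^∧ := Σ_{i=0}^{m-1} C^{(t^i)}` equals the
`K`-linear span of the trace code `Tr_{K/F}(C)` inside `K^n`. -/
theorem sum_powSet_eq_span_traceCode
    (q r t m : ℕ) (hq : IsPrimePow q) (ht : IsPrimePow t) (hr : 1 < r)
    (F K : Type*) [Field F] [Field K] [Fintype F] [Fintype K] [Algebra F K]
    (hK : Fintype.card K = q ^ r) (hF : Fintype.card F = t) (hm : q ^ r = t ^ m)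
    (n : ℕ) (C : Submodule K (Fin n → K)) :
    {x : Fin n → K | ∃ f : Fin m → (Fin n → K),
        (∀ i : Fin m, f i ∈ powSet (C : Set (Fin n → K)) (t ^ (i : ℕ))) ∧ x = ∑ i, f i}
      = ↑(Submodule.span K
          {x : Fin n → K | ∃ c ∈ C, ∀ j, x j = algebraMap F K (Algebra.trace F K (c j))}) := by
  classical
  have hcard : t ^ m = t ^ Module.finrank F K := by
    rw [← hm, ← hK, ← hF]; exact Module.card_eq_pow_finrank
  have hmr : m = Module.finrank F K := Nat.pow_right_injective ht.two_le hcard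
  -- the iterated Frobenius automorphisms
  have hσ : ∀ i : ℕ, ∃ σ : K ≃ₐ[F] K, ∀ x, σ x = x ^ (t ^ i) := by
    intro i
    refine ⟨FiniteField.frobeniusAlgEquivOfAlgebraic F K ^ i, fun x => ?_⟩
    rw [AlgEquiv.coe_pow, FiniteField.coe_frobeniusAlgEquivOfAlgebraic_iterate, hF]
  choose σ hσ using hσ
  have htr : ∀ x : K, algebraMap F K (Algebra.trace F K x) = ∑ i : Fin m, x ^ (t ^ (i : ℕ)) := by
    intro x
    rw [FiniteField.algebraMap_trace_eq_sum_pow, ← hmr, Finset.sum_range,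
      Nat.card_eq_fintype_card, hF]
  apply Set.Subset.antisymm
  · rintro x ⟨f, hf, rfl⟩
    refine Submodule.sum_mem _ fun i _ => ?_
    obtain ⟨c, hc, hci⟩ := hf i
    rw [← hci]
    let b := Module.finBasis F K
    have key : (fun j => c j ^ t ^ (i : ℕ)) = ∑ k, (σ i (b.traceDual k)) •
        (fun j => algebraMap F K (Algebra.trace F K (b k * c j))) := by
      funext j
      have h := b.traceDual.sum_repr (c j)
      rw [← hσ, Finset.sum_apply]
      conv_lhs => rw [← h]
      rw [map_sum]
      refine Finset.sum_congr rfl fun k _ => ?_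
      rw [map_smul, Module.Basis.traceDual_repr_apply, Algebra.traceForm_apply, Algebra.smul_def,
        Pi.smul_apply, smul_eq_mul, mul_comm, mul_comm (c j)]
    show (fun j => c j ^ t ^ (i : ℕ)) ∈ Submodule.span K _
    rw [key]
    refine Submodule.sum_mem _ fun k _ => Submodule.smul_mem _ _ (Submodule.subset_span ?_)
    exact ⟨b k • c, C.smul_mem _ hc, fun j => rfl⟩
  · intro x hx
    induction hx using Submodule.span_induction with
    | mem x hx =>
      obtain ⟨c, hc, hx⟩ := hx
      refine ⟨fun i j => c j ^ t ^ (i : ℕ), fun i => ⟨c, hc, rfl⟩, ?_⟩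
      funext j
      rw [hx, htr, Finset.sum_apply]
    | zero =>
      refine ⟨fun _ => 0, fun i => ⟨0, C.zero_mem, ?_⟩, by simp⟩
      funext j
      simp only [Pi.zero_apply]
      rw [← hσ, map_zero]
    | add x y _ _ hx hy =>
      obtain ⟨f, hf, rfl⟩ := hx
      obtain ⟨g, hg, rfl⟩ := hy
      refine ⟨fun i => f i + g i, fun i => ?_, by rw [Finset.sum_add_distrib]⟩
      obtain ⟨c, hc, hci⟩ := hf i
      obtain ⟨d, hd, hdi⟩ := hg i
      refine ⟨c + d, C.add_mem hc hd, ?_⟩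
      beta_reduce
      rw [← hci, ← hdi]
      funext j
      simp only [Pi.add_apply]
      rw [← hσ, ← hσ, ← hσ, map_add]
    | smul a x _ hx =>
      obtain ⟨f, hf, rfl⟩ := hx
      refine ⟨fun i => a • f i, fun i => ?_, by rw [Finset.smul_sum]⟩
      obtain ⟨c, hc, hci⟩ := hf i
      refine ⟨(σ i).symm a • c, C.smul_mem _ hc, ?_⟩
      beta_reduce
      rw [← hci]
      funext j
      simp only [Pi.smul_apply, smul_eq_mul]
      rw [← hσ, ← hσ, map_mul, AlgEquiv.apply_symm_apply]
end

section
/- Suppose q^r = t^m and let C be a linear code over F_{q^r} of length n. Then C^o := ∩_{i=0}^{m-1} C^{(t^i)} satisfies: the F_{q^r}-dimension of C^o equals the F_t-dimension of C|F_t, and the minimum Hamming distance of C^o equals the minimum Hamming distance of C|F_t (when both codes are nonzero). -/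
open scoped BigOperators

/-- Hamming weight of a vector: the number of nonzero coordinates. -/
noncomputable def hammingWt {n : ℕ} {α : Type*} [Zero α] (v : Fin n → α) : ℕ :=
  {i | v i ≠ 0}.ncard

/-- Minimum distance (minimum Hamming weight of a nonzero element) of a set of vectors. -/
noncomputable def minWt {n : ℕ} {α : Type*} [Zero α] (C : Set (Fin n → α)) : ℕ :=
  sInf {w | ∃ c ∈ C, c ≠ 0 ∧ hammingWt c = w}

theorem aux_exists_trace {F K : Type*} [Field F] [Field K] [Fintype F] [Fintype K] [Algebra F K]
    (a : K) (h : ∀ l : K, Algebra.trace F K (l * a) = 0) : a = 0 := by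
  have : FiniteDimensional F K := Module.Finite.of_finite
  refine (traceForm_nondegenerate F K).1 a ?_
  intro l
  rw [Algebra.traceForm_apply, mul_comm]
  exact h l

/-- coordinatewise embedding -/
def embF (F K : Type*) [Field F] [Field K] [Algebra F K] (n : ℕ) :
    (Fin n → F) →ₗ[F] (Fin n → K) :=
  LinearMap.pi fun i => (Algebra.linearMap F K).comp (LinearMap.proj i)

theorem aux_mem_pow {K : Type*} [Field K] [Fintype K] {t m n : ℕ} (hm : Fintype.card K = t ^ m)
    (hm0 : 0 < m)
    (C : Submodule K (Fin n → K)) (x : Fin n → K)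
    (hx : x ∈ ⋂ i ∈ Finset.range m, powSet (C : Set (Fin n → K)) (t ^ i)) (i : ℕ) (hi : i < m) :
    (fun k => x k ^ t ^ i) ∈ C := by
  simp only [Set.mem_iInter, Finset.mem_range] at hx
  rcases Nat.eq_zero_or_pos i with rfl | hpos
  · obtain ⟨c, hc, rfl⟩ := hx 0 hm0
    simpa using hc
  · obtain ⟨c, hc, rfl⟩ := hx (m - i) (by omega)
    have : (fun k => (c k ^ t ^ (m - i)) ^ t ^ i) = c := by
      funext k
      rw [← pow_mul, ← pow_add, Nat.sub_add_cancel hi.le, ← hm, FiniteField.pow_card]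
    simpa [this] using hc

theorem aux_trace_mem {F K : Type*} [Field F] [Field K] [Fintype F] [Fintype K] [Algebra F K]
    {m n : ℕ} (hm : Fintype.card K = Fintype.card F ^ m) (hm0 : 0 < m)
    (C : Submodule K (Fin n → K)) (x : Fin n → K)
    (hx : x ∈ ⋂ i ∈ Finset.range m, powSet (C : Set (Fin n → K)) (Fintype.card F ^ i)) (l : K) :
    (fun k => Algebra.trace F K (l * x k)) ∈ subfieldSubcode F C := by
  have : FiniteDimensional F K := Module.Finite.of_finite
  have hfr : Module.finrank F K = m := by
    have h := Module.card_eq_pow_finrank (K := F) (V := K)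
    rw [hm] at h
    exact (Nat.pow_right_injective (Fintype.one_lt_card (α := F)) h).symm
  change (fun k => algebraMap F K (Algebra.trace F K (l * x k))) ∈ C
  have : (fun k => algebraMap F K (Algebra.trace F K (l * x k))) =
      ∑ i ∈ Finset.range m, (l ^ Fintype.card F ^ i) • (fun k => x k ^ Fintype.card F ^ i) := by
    funext k
    rw [FiniteField.algebraMap_trace_eq_sum_pow, hfr]
    simp [Finset.sum_apply, mul_pow, Nat.card_eq_fintype_card]
  rw [this]
  exact C.sum_mem fun i hi => C.smul_mem _ (aux_mem_pow hm hm0 C x hx i (Finset.mem_range.1 hi))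

theorem aux_emb_mem {F K : Type*} [Field F] [Field K] [Fintype F] [Algebra F K]
    {m n : ℕ} (C : Submodule K (Fin n → K)) (d : Fin n → F) (hd : d ∈ subfieldSubcode F C) :
    embF F K n d ∈ ⋂ i ∈ Finset.range m, powSet (C : Set (Fin n → K)) (Fintype.card F ^ i) := by
  simp only [Set.mem_iInter]
  intro i _
  refine ⟨embF F K n d, hd, ?_⟩
  funext k
  change algebraMap F K (d k) ^ _ = algebraMap F K (d k)
  rw [← map_pow, FiniteField.pow_card_pow]

theorem aux_span {F K : Type*} [Field F] [Field K] [Fintype F] [Fintype K] [Algebra F K]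
    {m n : ℕ} (hm : Fintype.card K = Fintype.card F ^ m) (hm0 : 0 < m)
    (C : Submodule K (Fin n → K)) :
    Submodule.span K (⋂ i ∈ Finset.range m, powSet (C : Set (Fin n → K)) (Fintype.card F ^ i))
      = Submodule.span K (embF F K n '' (subfieldSubcode F C : Set (Fin n → F))) := by
  classical
  have : FiniteDimensional F K := Module.Finite.of_finite
  apply le_antisymm
  · rw [Submodule.span_le]
    intro x hx
    let b := Module.finBasis F K
    let b' := (Algebra.traceForm F K).dualBasis (traceForm_nondegenerate F K) b
    have : x = ∑ j, b' j • embF F K n (fun k => Algebra.trace F K (b j * x k)) := by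
      funext k
      conv_lhs => rw [← b'.sum_repr (x k)]
      rw [Finset.sum_apply]
      refine Finset.sum_congr rfl fun j _ => ?_
      rw [LinearMap.BilinForm.dualBasis_repr_apply, Algebra.traceForm_apply, Algebra.smul_def,
        mul_comm, mul_comm (x k)]
      rfl
    rw [this]
    exact Submodule.sum_mem _ fun j _ => Submodule.smul_mem _ _
      (Submodule.subset_span ⟨_, aux_trace_mem hm hm0 C x hx (b j), rfl⟩)
  · apply Submodule.span_mono
    rintro _ ⟨d, hd, rfl⟩
    exact aux_emb_mem C d hd

theorem aux_finrank {F K : Type*} [Field F] [Field K] [Fintype F] [Fintype K] [Algebra F K]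
    {n : ℕ} (D : Submodule F (Fin n → F)) :
    Module.finrank K (Submodule.span K (embF F K n '' (D : Set (Fin n → F))))
      = Module.finrank F D := by
  let b := Module.finBasis F D
  have hli : LinearIndependent K (fun j => embF F K n (b j : Fin n → F)) := by
    rw [Fintype.linearIndependent_iff]
    intro a ha j
    apply aux_exists_trace (F := F)
    intro l
    have hb : LinearIndependent F (fun j => (b j : Fin n → F)) :=
      b.linearIndependent.map' D.subtype (Submodule.ker_subtype D)
    refine Fintype.linearIndependent_iff.1 hb (fun j => Algebra.trace F K (l * a j)) ?_ j
    funext k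
    have h1 := congrArg (fun z => Algebra.trace F K (l * z)) (congrFun ha k)
    simp only [Finset.sum_apply, Finset.mul_sum, map_sum, Pi.zero_apply, mul_zero, map_zero] at h1
    rw [Finset.sum_apply, Pi.zero_apply, ← h1]
    refine Finset.sum_congr rfl fun i _ => ?_
    change Algebra.trace F K (l * a i) * (b i : Fin n → F) k =
      Algebra.trace F K (l * (a i * algebraMap F K ((b i : Fin n → F) k)))
    rw [← mul_assoc, mul_comm _ (algebraMap F K _), ← Algebra.smul_def, map_smul, smul_eq_mul,
      mul_comm]
  have hsp : Submodule.span K (embF F K n '' (D : Set (Fin n → F))) =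
      Submodule.span K (Set.range (fun j => embF F K n (b j : Fin n → F))) := by
    apply le_antisymm
    · rw [Submodule.span_le]
      rintro _ ⟨d, hd, rfl⟩
      have h := congrArg (fun z : D => embF F K n (z : Fin n → F)) (b.sum_repr ⟨d, hd⟩)
      simp only [Submodule.coe_sum, Submodule.coe_smul, map_sum, map_smul] at h
      rw [← h]
      refine Submodule.sum_mem _ fun j _ => ?_
      rw [← algebraMap_smul K]
      exact Submodule.smul_mem _ _ (Submodule.subset_span ⟨j, rfl⟩)
    · apply Submodule.span_mono
      rintro _ ⟨j, rfl⟩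
      exact ⟨_, (b j).2, rfl⟩
  rw [hsp, finrank_span_eq_card hli, Fintype.card_fin]

/-- Suppose `q^r = t^m`, `K = F_{q^r}` and `F = F_t` is a subfield of `K`. For a linear
code `C` of length `n` over `K`, the code `C^o := ∩_{i=0}^{m-1} C^{(t^i)}` has
`K`-dimension equal to the `F`-dimension of the subfield subcode `C|F_t`, and (when both
codes are nonzero) the same minimum Hamming distance as `C|F_t`. -/
theorem finrank_minWt_iInter_powSet_eq_subfieldSubcode
    (q r t m : ℕ) (hq : IsPrimePow q) (ht : IsPrimePow t) (hr : 1 < r)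
    (F K : Type*) [Field F] [Field K] [Fintype F] [Fintype K] [Algebra F K]
    (hK : Fintype.card K = q ^ r) (hF : Fintype.card F = t) (hm : q ^ r = t ^ m)
    (n : ℕ) (C : Submodule K (Fin n → K)) :
    Module.finrank K
        (Submodule.span K (⋂ i ∈ Finset.range m, powSet (C : Set (Fin n → K)) (t ^ i)))
      = Module.finrank F (subfieldSubcode F C)
    ∧ ((∃ x ∈ ⋂ i ∈ Finset.range m, powSet (C : Set (Fin n → K)) (t ^ i), x ≠ 0) →
        subfieldSubcode F C ≠ ⊥ →
        minWt (⋂ i ∈ Finset.range m, powSet (C : Set (Fin n → K)) (t ^ i))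
          = minWt (subfieldSubcode F C : Set (Fin n → F))) := by
  subst hF
  rw [hm] at hK
  have hm0 : 0 < m := by
    rcases Nat.eq_zero_or_pos m with rfl | h
    · have := Fintype.one_lt_card (α := K)
      rw [hK] at this
      simp at this
    · exact h
  refine ⟨by rw [aux_span hK hm0, aux_finrank], ?_⟩
  rintro ⟨x, hx, hx0⟩ hD
  obtain ⟨d, hd, hd0⟩ := (Submodule.ne_bot_iff _).1 hD
  apply le_antisymm
  · obtain ⟨c, hc, hc0, hw⟩ := Nat.sInf_mem
      (s := {w | ∃ c ∈ (subfieldSubcode F C : Set (Fin n → F)), c ≠ 0 ∧ hammingWt c = w})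
      ⟨_, d, hd, hd0, rfl⟩
    refine Nat.sInf_le ⟨embF F K n c, aux_emb_mem C c hc, ?_, ?_⟩
    · intro h
      apply hc0
      funext k
      exact (algebraMap F K).injective ((congrFun h k).trans (map_zero _).symm)
    · refine Eq.trans ?_ hw
      unfold hammingWt
      congr 1
      ext k
      change algebraMap F K (c k) ≠ 0 ↔ c k ≠ 0
      simp
  · obtain ⟨c, hc, hc0, hw⟩ := Nat.sInf_mem
      (s := {w | ∃ c ∈ (⋂ i ∈ Finset.range m, powSet (C : Set (Fin n → K)) (Fintype.card F ^ i)),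
        c ≠ 0 ∧ hammingWt c = w})
      ⟨_, x, hx, hx0, rfl⟩
    obtain ⟨k, hk⟩ := Function.ne_iff.1 hc0
    obtain ⟨l, hl⟩ : ∃ l : K, Algebra.trace F K (l * c k) ≠ 0 := by
      by_contra! h
      exact hk (aux_exists_trace _ h)
    refine le_trans (Nat.sInf_le ⟨_, aux_trace_mem hK hm0 C c hc l, ?_, rfl⟩) (le_trans ?_ hw.le)
    · intro h
      exact hl (congrFun h k)
    · refine Set.ncard_le_ncard ?_ (Set.toFinite _)
      intro j hj hcj
      apply hj
      simp [hcj]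
end

section
/- Suppose q^r = t^m and let C be a linear code over F_{q^r} of length n. Then C^∧ := Σ_{i=0}^{m-1} C^{(t^i)} satisfies: the F_{q^r}-dimension of C^∧ equals the F_t-dimension of Tr_{F_{q^r}/F_t}(C), and the minimum Hamming distance of C^∧ equals the minimum Hamming distance of Tr_{F_{q^r}/F_t}(C) (when both codes are nonzero). -/
open scoped BigOperators

/-- Coordinatewise embedding of `F^n` into `K^n`. -/
noncomputable def embVec (F K : Type*) [Field F] [Field K] [Algebra F K] {n : ℕ} :
    (Fin n → F) →ₗ[F] (Fin n → K) :=
  LinearMap.pi fun i => (Algebra.linearMap F K).comp (LinearMap.proj i)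

/-- The map `x ↦ (Tr (b x_i))_i`. -/
noncomputable def trVec (F : Type*) {K : Type*} [Field F] [Field K] [Algebra F K] {n : ℕ} (b : K) :
    (Fin n → K) →ₗ[F] (Fin n → F) :=
  LinearMap.pi fun i => ((Algebra.trace F K).comp (LinearMap.mulLeft F b)).comp (LinearMap.proj i)

/-- The sum code as a set. -/
def hatSet {K : Type*} [Field K] {n : ℕ} (t m : ℕ) (C : Submodule K (Fin n → K)) :
    Set (Fin n → K) :=
  {x : Fin n → K | ∃ f : Fin m → (Fin n → K),
          (∀ i : Fin m, f i ∈ powSet (C : Set (Fin n → K)) (t ^ (i : ℕ))) ∧ x = ∑ i, f i}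

section
variable {F K : Type*} [Field F] [Field K] [Algebra F K] {n : ℕ}

@[simp] lemma embVec_apply (v : Fin n → F) (i : Fin n) :
    embVec F K v i = algebraMap F K (v i) := rfl

@[simp] lemma trVec_apply (b : K) (v : Fin n → K) (i : Fin n) :
    trVec F b v i = Algebra.trace F K (b * v i) := rfl

lemma trVec_mem (C : Submodule K (Fin n → K)) (b : K) {c : Fin n → K} (hc : c ∈ C) :
    trVec F b c ∈ traceCode F C :=
  ⟨b • c, C.smul_mem b hc, rfl⟩

lemma trVec_smul_emb (b a : K) (v : Fin n → F) :
    trVec F b (a • embVec F K v) = Algebra.trace F K (b * a) • v := by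
  ext i
  have : b * (a * algebraMap F K (v i)) = (v i) • (b * a) := by
    rw [Algebra.smul_def]; ring
  simp [this, mul_comm]

lemma trVec_span_mem (T : Submodule F (Fin n → F)) (b : K) {x : Fin n → K}
    (hx : x ∈ Submodule.span K (embVec F K '' (T : Set (Fin n → F)))) :
    trVec F b x ∈ T := by
  induction hx using Submodule.span_induction generalizing b with
  | mem x h =>
    obtain ⟨v, hv, rfl⟩ := h
    have := trVec_smul_emb (F := F) b 1 v
    rw [one_smul] at this
    rw [this]
    exact T.smul_mem _ hv
  | zero => simp
  | add x y _ _ hx hy => rw [map_add]; exact T.add_mem (hx b) (hy b)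
  | smul a x _ hx =>
    have : trVec F b (a • x) = trVec F (b * a) x := by
      ext i; simp [mul_assoc]
    rw [this]; exact hx _

lemma exists_trace_ne [FiniteDimensional F K] [Algebra.IsSeparable F K] {a : K} (ha : a ≠ 0) :
    ∃ b, Algebra.trace F K (b * a) ≠ 0 := by
  have htr := (traceForm_nondegenerate F K).1 a
  simp_rw [Algebra.traceForm_apply] at htr
  by_contra! hf
  exact ha (htr fun b => by rw [mul_comm]; exact hf b)

lemma finrank_span_emb [FiniteDimensional F K] [Algebra.IsSeparable F K]
    (T : Submodule F (Fin n → F)) :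
    Module.finrank K (Submodule.span K (embVec F K '' (T : Set (Fin n → F))))
      = Module.finrank F T := by
  let B := Module.finBasis F T
  have hli : LinearIndependent K (fun k => embVec F K (B k : Fin n → F)) := by
    rw [Fintype.linearIndependent_iff]
    intro a ha k
    by_contra hk
    obtain ⟨b, hb⟩ := exists_trace_ne (F := F) hk
    have h := congrArg (trVec F b) ha
    rw [map_sum, map_zero] at h
    simp_rw [trVec_smul_emb] at h
    have hB : LinearIndependent F (fun k => (B k : Fin n → F)) :=
      B.linearIndependent.map' T.subtype T.ker_subtype
    exact hb (Fintype.linearIndependent_iff.1 hB _ h k)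
  have hspan : Submodule.span K (embVec F K '' (T : Set (Fin n → F)))
      = Submodule.span K (Set.range fun k => embVec F K (B k : Fin n → F)) := by
    apply le_antisymm
    · rw [Submodule.span_le]
      rintro _ ⟨v, hv, rfl⟩
      have h : v = ∑ k, B.repr ⟨v, hv⟩ k • (B k : Fin n → F) := by
        have := congrArg T.subtype (B.sum_repr ⟨v, hv⟩)
        rw [map_sum] at this
        exact this.symm
      rw [h, map_sum]
      refine Submodule.sum_mem _ fun k _ => ?_
      rw [map_smul, ← algebraMap_smul K]
      exact Submodule.smul_mem _ _ (Submodule.subset_span ⟨k, rfl⟩)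
    · refine Submodule.span_mono ?_
      rintro _ ⟨k, rfl⟩
      exact ⟨_, (B k).2, rfl⟩
  rw [hspan, finrank_span_eq_card hli, Fintype.card_fin]

lemma hatSet_eq [Fintype F] [Fintype K] (t m : ℕ) (hF : Fintype.card F = t)
    (hm : Module.finrank F K = m) (C : Submodule K (Fin n → K)) :
    hatSet t m C =
      (Submodule.span K (embVec F K '' (traceCode F C : Set (Fin n → F))) : Set (Fin n → K)) := by
  have hσ : ∀ i : ℕ, ∃ σ : K ≃ₐ[F] K, ∀ x, σ x = x ^ t ^ i := fun i =>
    ⟨FiniteField.frobeniusAlgEquivOfAlgebraic F K ^ i, fun x => by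
      rw [AlgEquiv.coe_pow, FiniteField.coe_frobeniusAlgEquivOfAlgebraic_iterate, hF]⟩
  choose σ hσ using hσ
  apply Set.Subset.antisymm
  · rintro _ ⟨f, hf, rfl⟩
    refine Submodule.sum_mem _ fun i _ => ?_
    obtain ⟨c, hc, hci⟩ := hf i
    rw [← hci]
    let b := Module.finBasis F K
    have h : (fun j => c j ^ t ^ (i : ℕ))
        = ∑ k, (σ i (b.traceDual k)) • embVec F K (trVec F (b k) c) := by
      ext j
      have h1 := b.traceDual.sum_repr (c j)
      simp only [Module.Basis.traceDual_repr_apply, Algebra.traceForm_apply] at h1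
      rw [← hσ]
      conv_lhs => rw [← h1]
      simp [Finset.sum_apply, Algebra.smul_def, mul_comm]
    change (fun j => c j ^ t ^ (i : ℕ)) ∈ _
    rw [h]
    exact Submodule.sum_mem _ fun k _ => Submodule.smul_mem _ _
      (Submodule.subset_span ⟨_, trVec_mem C _ hc, rfl⟩)
  · intro x hx
    induction hx using Submodule.span_induction with
    | mem x h =>
      obtain ⟨_, ⟨c, hc, rfl⟩, rfl⟩ := h
      refine ⟨fun i j => c j ^ t ^ (i : ℕ), fun i => ⟨c, hc, rfl⟩, ?_⟩
      ext j
      have := FiniteField.algebraMap_trace_eq_sum_pow F K (c j)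
      rw [hm, Nat.card_eq_fintype_card, hF, Finset.sum_range] at this
      simpa [Finset.sum_apply] using this
    | zero =>
      refine ⟨0, fun i => ⟨0, C.zero_mem, ?_⟩, by simp⟩
      ext j
      have := hσ i 0
      rw [map_zero] at this
      exact this.symm
    | add x y _ _ hx hy =>
      obtain ⟨f, hf, rfl⟩ := hx
      obtain ⟨g, hg, rfl⟩ := hy
      refine ⟨f + g, fun i => ?_, by simp [Finset.sum_add_distrib]⟩
      obtain ⟨c, hc, h1⟩ := hf i
      obtain ⟨d, hd, h2⟩ := hg i
      refine ⟨c + d, C.add_mem hc hd, ?_⟩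
      rw [Pi.add_apply, ← h1, ← h2]
      ext j
      simp [← hσ]
    | smul a x _ hx =>
      obtain ⟨f, hf, rfl⟩ := hx
      refine ⟨fun i => a • f i, fun i => ?_, by rw [Finset.smul_sum]⟩
      obtain ⟨c, hc, h1⟩ := hf i
      refine ⟨(σ i).symm a • c, C.smul_mem _ hc, ?_⟩
      beta_reduce
      rw [← h1]
      ext j
      simp [← hσ]

lemma minWt_span_emb [FiniteDimensional F K] [Algebra.IsSeparable F K]
    (T : Submodule F (Fin n → F)) (hT : T ≠ ⊥) :
    minWt (Submodule.span K (embVec F K '' (T : Set (Fin n → F))) : Set (Fin n → K))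
      = minWt (T : Set (Fin n → F)) := by
  have hinj := FaithfulSMul.algebraMap_injective F K
  have key : ∀ v ∈ T, v ≠ 0 →
      hammingWt v ∈ {w | ∃ c ∈ (Submodule.span K (embVec F K '' (T : Set (Fin n → F))) :
        Set (Fin n → K)), c ≠ 0 ∧ hammingWt c = w} := by
    intro v hv h0
    refine ⟨embVec F K v, Submodule.subset_span ⟨v, hv, rfl⟩, ?_, ?_⟩
    · intro h
      apply h0
      ext i
      have := congrFun h i
      simpa using this
    · simp [hammingWt]
  obtain ⟨v, hv, hv0⟩ := T.exists_mem_ne_zero_of_ne_bot hT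
  apply le_antisymm
  · refine le_csInf ⟨_, v, hv, hv0, rfl⟩ ?_
    rintro w ⟨c, hc, hc0, rfl⟩
    exact Nat.sInf_le (key c hc hc0)
  · refine le_csInf ⟨_, key v hv hv0⟩ ?_
    rintro w ⟨c, hc, hc0, rfl⟩
    obtain ⟨j, hj⟩ := Function.ne_iff.1 hc0
    obtain ⟨b, hb⟩ := exists_trace_ne (F := F) hj
    have hle : minWt (T : Set (Fin n → F)) ≤ hammingWt (trVec F b c) :=
      Nat.sInf_le ⟨trVec F b c, trVec_span_mem T b hc, Function.ne_iff.2 ⟨j, hb⟩, rfl⟩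
    refine hle.trans ?_
    refine Set.ncard_le_ncard ?_ (Set.toFinite _)
    intro i hi h
    apply hi
    simp [h]

end

/-- Suppose `q^r = t^m`, `K = F_{q^r}` and `F = F_t` is a subfield of `K`. For a linear
code `C` of length `n` over `K`, the code `C^∧ := Σ_{i=0}^{m-1} C^{(t^i)}` has
`K`-dimension equal to the `F`-dimension of the trace code `Tr_{K/F}(C)`, and (when both
codes are nonzero) the same minimum Hamming distance as `Tr_{K/F}(C)`. -/
theorem finrank_minWt_sum_powSet_eq_traceCode
    (q r t m : ℕ) (hq : IsPrimePow q) (ht : IsPrimePow t) (hr : 1 < r)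
    (F K : Type*) [Field F] [Field K] [Fintype F] [Fintype K] [Algebra F K]
    (hK : Fintype.card K = q ^ r) (hF : Fintype.card F = t) (hm : q ^ r = t ^ m)
    (n : ℕ) (C : Submodule K (Fin n → K)) :
    Module.finrank K (Submodule.span K
        {x : Fin n → K | ∃ f : Fin m → (Fin n → K),
          (∀ i : Fin m, f i ∈ powSet (C : Set (Fin n → K)) (t ^ (i : ℕ))) ∧ x = ∑ i, f i})
      = Module.finrank F (traceCode F C)
    ∧ ((∃ x ∈ {x : Fin n → K | ∃ f : Fin m → (Fin n → K),
          (∀ i : Fin m, f i ∈ powSet (C : Set (Fin n → K)) (t ^ (i : ℕ))) ∧ x = ∑ i, f i},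
          x ≠ 0) →
        traceCode F C ≠ ⊥ →
        minWt {x : Fin n → K | ∃ f : Fin m → (Fin n → K),
            (∀ i : Fin m, f i ∈ powSet (C : Set (Fin n → K)) (t ^ (i : ℕ))) ∧ x = ∑ i, f i}
          = minWt (traceCode F C : Set (Fin n → F))) := by
  have hfin : Module.finrank F K = m := by
    have h := Module.card_eq_pow_finrank (K := F) (V := K)
    rw [hK, hm, hF] at h
    exact (Nat.pow_right_injective ht.two_le h).symm
  have hS := hatSet_eq t m hF hfin C
  unfold hatSet at hS
  rw [hS]
  refine ⟨?_, fun _ hT => minWt_span_emb _ hT⟩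
  rw [Submodule.span_eq]
  exact finrank_span_emb _
end

section
/- Let q be a prime power, r > 1, and let u divide (q^r−1)/(q−1). Then the number of points of the extended Norm–Trace curve satisfies #NT_u = q^{r−1}(u(q−1)+1), where NT_u = {(x,y) ∈ F_{q^r}^2 : x^u = Tr_{F_{q^r}/F_q}(y)}. -/
open scoped BigOperators

/-- The extended Norm--Trace curve `x^u = Tr_{F_{q^r}/F_q}(y) = ∑_{i<r} y^{q^i}`. -/
def ntCurve (K : Type*) [Field K] (q r u : ℕ) : Set (K × K) :=
  {P | P.1 ^ u = ∑ i ∈ Finset.range r, P.2 ^ q ^ i}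

theorem nt_fiber_le (K : Type*) [Field K] [Fintype K] [DecidableEq K] (q r : ℕ) (hq : 1 < q)
    (hr : 1 < r) (c : K) :
    (Finset.univ.filter fun y : K => ∑ i ∈ Finset.range r, y ^ q ^ i = c).card ≤ q ^ (r - 1) := by
  obtain ⟨s, rfl⟩ : ∃ s, r = s + 1 := ⟨r - 1, by omega⟩
  let g : Polynomial K := ∑ i ∈ Finset.range s, Polynomial.X ^ q ^ i - Polynomial.C c
  let f : Polynomial K := Polynomial.X ^ q ^ s + g
  have hs : q ^ 0 < q ^ s := Nat.pow_lt_pow_right hq (by omega)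
  have hg : g.degree < ((q ^ s : ℕ) : WithBot ℕ) := by
    refine (Polynomial.degree_sub_le _ _).trans_lt (max_lt ?_ ?_)
    · refine (Polynomial.degree_sum_le _ _).trans_lt ?_
      rw [Finset.sup_lt_iff (WithBot.bot_lt_coe _)]
      intro i hi
      rw [Polynomial.degree_X_pow]
      exact_mod_cast Nat.pow_lt_pow_right hq (Finset.mem_range.1 hi)
    · refine Polynomial.degree_C_le.trans_lt ?_
      exact_mod_cast (by simpa using Nat.zero_lt_of_lt hs)
  have hf : f.natDegree = q ^ s := by
    apply Polynomial.natDegree_eq_of_degree_eq_some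
    rw [show f = Polynomial.X ^ q ^ s + g from rfl,
      Polynomial.degree_add_eq_left_of_degree_lt, Polynomial.degree_X_pow]
    rwa [Polynomial.degree_X_pow]
  have hf0 : f ≠ 0 := by
    intro h
    rw [h, Polynomial.natDegree_zero] at hf
    omega
  calc _ ≤ f.roots.toFinset.card := by
        apply Finset.card_le_card
        intro y hy
        rw [Finset.mem_filter, Finset.sum_range_succ] at hy
        rw [Multiset.mem_toFinset, Polynomial.mem_roots hf0, Polynomial.IsRoot.def]
        simp only [f, g, Polynomial.eval_add, Polynomial.eval_sub, Polynomial.eval_pow,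
          Polynomial.eval_X, Polynomial.eval_C, Polynomial.eval_finsetSum]
        rw [← hy.2]; ring
    _ ≤ f.roots.card := Multiset.toFinset_card_le _
    _ ≤ f.natDegree := Polynomial.card_roots' _
    _ = _ := by rw [hf]; simp

theorem nt_fix_le (K : Type*) [Field K] [Fintype K] [DecidableEq K] (q : ℕ) (hq : 1 < q) :
    (Finset.univ.filter fun z : K => z ^ q = z).card ≤ q := by
  have hf0 : (Polynomial.X ^ q - Polynomial.X : Polynomial K) ≠ 0 :=
    FiniteField.X_pow_card_sub_X_ne_zero K hq
  calc _ ≤ (Polynomial.X ^ q - Polynomial.X : Polynomial K).roots.toFinset.card := by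
        apply Finset.card_le_card
        intro y hy
        rw [Finset.mem_filter] at hy
        rw [Multiset.mem_toFinset, Polynomial.mem_roots hf0, Polynomial.IsRoot.def]
        simp [hy.2]
    _ ≤ _ := Multiset.toFinset_card_le _
    _ ≤ _ := Polynomial.card_roots' _
    _ = _ := FiniteField.X_pow_card_sub_X_natDegree_eq K hq

theorem nt_trace_fix (K : Type*) [Field K] [Fintype K] (q r : ℕ) (hq : IsPrimePow q)
    (hK : Fintype.card K = q ^ r) (y : K) :
    (∑ i ∈ Finset.range r, y ^ q ^ i) ^ q = ∑ i ∈ Finset.range r, y ^ q ^ i := by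
  have hy : y ^ q ^ r = y := by rw [← hK]; exact FiniteField.pow_card y
  have h1 : (∑ i ∈ Finset.range r, y ^ q ^ i) ^ q = ∑ i ∈ Finset.range r, (y ^ q ^ i) ^ q := by
    obtain ⟨p, k, hp, hk, rfl⟩ := hq
    have : Fact p.Prime := ⟨hp.nat_prime⟩
    rw [← pow_mul] at hK
    have : CharP K p := charP_of_card_eq_prime_pow hK
    exact sum_pow_char_pow ..
  rw [h1]
  have h2 := Finset.sum_range_succ (fun i => y ^ q ^ i) r
  rw [Finset.sum_range_succ', hy] at h2
  simp only [pow_zero, pow_one] at h2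
  simp only [← pow_mul, ← pow_succ]
  exact add_right_cancel h2

theorem nt_fiber_eq (K : Type*) [Field K] [Fintype K] [DecidableEq K] (q r : ℕ)
    (hq : IsPrimePow q) (hr : 1 < r) (hK : Fintype.card K = q ^ r) (c : K) (hc : c ^ q = c) :
    (Finset.univ.filter fun y : K => ∑ i ∈ Finset.range r, y ^ q ^ i = c).card = q ^ (r - 1) := by
  have h1 := Finset.card_eq_sum_card_fiberwise (s := (Finset.univ : Finset K))
    (t := Finset.univ.filter fun z : K => z ^ q = z)
    (f := fun y : K => ∑ i ∈ Finset.range r, y ^ q ^ i)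
    (fun y _ => by simpa using nt_trace_fix K q r hq hK y)
  have h2 : ∀ c ∈ Finset.univ.filter fun z : K => z ^ q = z,
    (Finset.univ.filter fun y : K => ∑ i ∈ Finset.range r, y ^ q ^ i = c).card ≤ q ^ (r - 1) :=
    fun c _ => nt_fiber_le K q r hq.one_lt hr c
  have h3 : ∑ c ∈ Finset.univ.filter fun z : K => z ^ q = z, q ^ (r - 1) ≤ q ^ r := by
    rw [Finset.sum_const, smul_eq_mul]
    calc _ ≤ q * q ^ (r - 1) := Nat.mul_le_mul_right _ (nt_fix_le K q hq.one_lt)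
      _ = _ := mul_pow_sub_one (by omega) q
  rw [Finset.card_univ, hK] at h1
  refine (Finset.sum_eq_sum_iff_of_le h2).1 (le_antisymm (Finset.sum_le_sum h2) ?_) c (by simpa)
  exact h3.trans h1.le

theorem nt_count (K : Type*) [Field K] [Fintype K] [DecidableEq K] (q r u : ℕ)
    (hq : 1 < q) (hu : 0 < u) (hdvd : u ∣ (q ^ r - 1) / (q - 1))
    (hK : Fintype.card K = q ^ r) :
    (Finset.univ.filter fun x : K => (x ^ u) ^ q = x ^ u).card = u * (q - 1) + 1 := by
  have hn : 0 < u * (q - 1) := Nat.mul_pos hu (by omega)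
  obtain ⟨m, hm⟩ : u * (q - 1) ∣ q ^ r - 1 := by
    have := Nat.mul_dvd_mul_right hdvd (q - 1)
    rwa [Nat.div_mul_cancel (Nat.sub_one_dvd_pow_sub_one q r)] at this
  obtain ⟨g, hg⟩ := IsCyclic.exists_generator (α := Kˣ)
  have hcard : orderOf g = q ^ r - 1 := by
    rw [orderOf_eq_card_of_forall_mem_zpowers hg, Nat.card_eq_fintype_card,
      Fintype.card_units, hK]
  have hpr : IsPrimitiveRoot (g : K) (q ^ r - 1) := by
    rw [← hcard]
    exact (IsPrimitiveRoot.orderOf g).map_of_injective (f := Units.coeHom K) Units.val_injective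
  have hpos : 0 < q ^ r - 1 := by rw [← hcard]; exact orderOf_pos g
  have hz := hpr.pow hpos (hm.trans (mul_comm _ _))
  rw [show (Finset.univ.filter fun x : K => (x ^ u) ^ q = x ^ u) =
    insert 0 (Polynomial.nthRootsFinset (u * (q - 1)) (1 : K)) from ?_,
    Finset.card_insert_of_notMem, hz.card_nthRootsFinset]
  · rw [Polynomial.mem_nthRootsFinset hn]
    simp [hn.ne']
  · ext x
    rw [Finset.mem_insert, Polynomial.mem_nthRootsFinset hn, Finset.mem_filter]
    by_cases hx : x = 0
    · simp [hx, hu.ne']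
      omega
    · have hxu : x ^ u ≠ 0 := pow_ne_zero _ hx
      simp only [hx, false_or, Finset.mem_univ, true_and]
      rw [pow_mul, ← mul_pow_sub_one (by omega : q ≠ 0) (x ^ u), mul_eq_left₀ hxu]

/-- Let `q` be a prime power, `r > 1`, and `u` a positive divisor of `(q^r - 1)/(q - 1)`.
Then the extended Norm--Trace curve over `F_{q^r}` has exactly `q^{r-1}(u(q-1) + 1)`
points. -/
theorem card_ntCurve (q r u : ℕ) (hq : IsPrimePow q) (hr : 1 < r)
    (hu : 0 < u) (hdvd : u ∣ (q ^ r - 1) / (q - 1))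
    (K : Type*) [Field K] [Fintype K] (hK : Fintype.card K = q ^ r) :
    Nat.card (ntCurve K q r u) = q ^ (r - 1) * (u * (q - 1) + 1) := by
  classical
  have h1 : Nat.card (ntCurve K q r u) = (Finset.univ.filter fun P : K × K =>
      P.1 ^ u = ∑ i ∈ Finset.range r, P.2 ^ q ^ i).card := by
    rw [Nat.card_eq_fintype_card, ← Set.toFinset_card]
    congr 1
    ext P
    rw [Set.mem_toFinset, Finset.mem_filter]
    exact ⟨fun h => ⟨Finset.mem_univ _, h⟩, fun h => h.2⟩
  rw [h1, ← nt_count K q r u hq.one_lt hu hdvd hK]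
  rw [Finset.card_eq_sum_card_fiberwise (f := Prod.fst)
    (t := Finset.univ.filter fun x : K => (x ^ u) ^ q = x ^ u), mul_comm]
  · apply Finset.sum_const_nat
    intro x hx
    rw [← nt_fiber_eq K q r hq hr hK (x ^ u) (Finset.mem_filter.1 hx).2]
    symm
    apply Finset.card_bij (fun y _ => (x, y))
    · intro y hy
      simpa using (Finset.mem_filter.1 hy).2.symm
    · intro a _ b _ h
      exact (Prod.mk.inj h).2
    · rintro ⟨a, b⟩ hab
      simp only [Finset.mem_filter, Finset.mem_univ, true_and] at hab
      obtain ⟨hab, rfl⟩ := hab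
      exact ⟨b, by simpa using hab.symm, rfl⟩
  · rintro ⟨a, b⟩ hab
    simp only [Finset.coe_filter, Finset.mem_univ, true_and, Set.mem_ofPred_eq] at hab ⊢
    rw [hab]
    exact nt_trace_fix K q r hq hK b
end

section
/- Let q be a prime power, r > 1, and u a divisor of (q^r−1)/(q−1). The ideal of polynomials in F_{q^r}[X,Y] vanishing at every point of the extended Norm–Trace curve NT_u is generated by the two polynomials X^u − Tr_{F_{q^r}/F_q}(Y) and X^{u(q−1)+1} − X, where Tr_{F_{q^r}/F_q}(Y) = Σ_{i=0}^{r−1} Y^{q^i}. -/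
open scoped BigOperators
open MvPolynomial

lemma nt_trace_pow {R : Type*} [CommRing R] (p k : ℕ) [ExpChar R p] (r : ℕ) (y : R) :
    (∑ i ∈ Finset.range r, y ^ (p ^ k) ^ i) ^ (p ^ k) - ∑ i ∈ Finset.range r, y ^ (p ^ k) ^ i
      = y ^ (p ^ k) ^ r - y := by
  rw [sum_pow_char_pow]
  have h : ∀ i ∈ Finset.range r, (y ^ (p ^ k) ^ i) ^ (p ^ k) = y ^ (p ^ k) ^ (i + 1) := by
    intro i _
    rw [← pow_mul, ← pow_succ]
  rw [Finset.sum_congr rfl h, ← Finset.sum_sub_distrib,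
    Finset.sum_range_sub (fun i => y ^ (p ^ k) ^ i)]
  simp

lemma nt_dvd {R : Type*} [CommRing R] (m n : ℕ) (hn : 0 < n) (h : m ∣ n - 1) (x : R) :
    x ^ (m + 1) - x ∣ x ^ n - x := by
  obtain ⟨c, hc⟩ := h
  obtain rfl : n = m * c + 1 := by omega
  have h1 : x ^ m - 1 ∣ x ^ (m * c) - 1 := by
    rw [pow_mul]
    exact sub_one_dvd_pow_sub_one _ _
  have e1 : x ^ (m + 1) - x = x * (x ^ m - 1) := by ring
  have e2 : x ^ (m * c + 1) - x = x * (x ^ (m * c) - 1) := by ring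
  rw [e1, e2]
  exact mul_dvd_mul_left _ h1

lemma nt_prod (K : Type*) [Field K] [Fintype K] :
    ∏ a : K, (Polynomial.X - Polynomial.C a)
      = (Polynomial.X ^ Fintype.card K - Polynomial.X : Polynomial K) := by
  have hm : (Polynomial.X ^ Fintype.card K - Polynomial.X : Polynomial K).Monic :=
    Polynomial.monic_X_pow_sub (by simpa using Fintype.one_lt_card (α := K))
  have h := Polynomial.prod_multiset_X_sub_C_of_monic_of_roots_card_eq hm (by
    rw [FiniteField.roots_X_pow_card_sub_X,
      FiniteField.X_pow_card_sub_X_natDegree_eq K Fintype.one_lt_card]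
    rfl)
  rw [FiniteField.roots_X_pow_card_sub_X] at h
  exact h

lemma nt_mem_of_vanish {K : Type*} [Field K] [Fintype K] {σ : Type*} [Finite σ]
    (I : Ideal (MvPolynomial σ K))
    (hI : ∀ i, (X i : MvPolynomial σ K) ^ Fintype.card K - X i ∈ I)
    (f : MvPolynomial σ K) (hf : ∀ x, eval x f = 0) : f ∈ I := by
  obtain ⟨h, -, hh⟩ := combinatorial_nullstellensatz_exists_linearCombination
    (fun _ : σ => (Finset.univ : Finset K)) (fun _ => Finset.univ_nonempty) f (fun x _ => hf x)
  rw [hh, Finsupp.linearCombination_apply, Finsupp.sum]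
  refine I.sum_mem fun i _ => ?_
  rw [smul_eq_mul]
  refine I.mul_mem_left _ ?_
  have := congrArg (Polynomial.aeval (X i : MvPolynomial σ K)) (nt_prod K)
  simp [map_prod, MvPolynomial.algebraMap_eq] at this
  rw [this]
  exact hI i

/-- Let `q` be a prime power, `r > 1`, and `u` a positive divisor of `(q^r - 1)/(q - 1)`.
The ideal of polynomials in `F_{q^r}[X, Y]` vanishing on the extended Norm--Trace curve
is generated by `X^u - Tr_{F_{q^r}/F_q}(Y)` and `X^{u(q-1)+1} - X`, where
`Tr_{F_{q^r}/F_q}(Y) = ∑_{i<r} Y^{q^i}`. -/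
theorem vanishingIdeal_ntCurve (q r u : ℕ) (hq : IsPrimePow q) (hr : 1 < r)
    (hu : 0 < u) (hdvd : u ∣ (q ^ r - 1) / (q - 1))
    (K : Type*) [Field K] [Fintype K] (hK : Fintype.card K = q ^ r) :
    {f : MvPolynomial (Fin 2) K | ∀ P ∈ ntCurve K q r u, eval ![P.1, P.2] f = 0}
      = ↑(Ideal.span
          {(X 0 : MvPolynomial (Fin 2) K) ^ u - ∑ i ∈ Finset.range r, X 1 ^ q ^ i,
           (X 0 : MvPolynomial (Fin 2) K) ^ (u * (q - 1) + 1) - X 0}) := by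
  obtain ⟨p, k, hp, hk, rfl⟩ := hq
  have hp' : p.Prime := hp.nat_prime
  have : Fact p.Prime := ⟨hp'⟩
  have : CharP K p := charP_of_card_eq_prime_pow (f := k * r) (by rw [hK, pow_mul])
  have hq1 : 1 < p ^ k := Nat.one_lt_pow hk.ne' hp'.one_lt
  generalize hq : p ^ k = q at *
  have hu1 : u * (q - 1) ∣ q ^ r - 1 := by
    have h1 : q - 1 ∣ q ^ r - 1 := by simpa using Nat.sub_dvd_pow_sub_pow q 1 r
    obtain ⟨c, hc⟩ := hdvd
    refine ⟨c, ?_⟩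
    rw [← Nat.div_mul_cancel h1, hc]
    ring
  have huq : ∀ {R : Type _} [CommRing R] (x : R),
      (x ^ u) ^ q - x ^ u = x ^ (u - 1) * (x ^ (u * (q - 1) + 1) - x) := by
    intro R _ x
    rw [mul_sub, ← pow_add, ← pow_succ, ← pow_mul]
    obtain ⟨v, rfl⟩ : ∃ v, u = v + 1 := ⟨u - 1, by omega⟩
    obtain ⟨w, rfl⟩ : ∃ w, q = w + 1 := ⟨q - 1, by omega⟩
    simp only [Nat.add_sub_cancel]
    congr 2
    ring
  ext f
  simp only [Set.mem_ofPred_eq, SetLike.mem_coe]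
  set I := Ideal.span
          {(X 0 : MvPolynomial (Fin 2) K) ^ u - ∑ i ∈ Finset.range r, X 1 ^ q ^ i,
           (X 0 : MvPolynomial (Fin 2) K) ^ (u * (q - 1) + 1) - X 0} with hI
  have hA : (X 0 : MvPolynomial (Fin 2) K) ^ u - ∑ i ∈ Finset.range r, X 1 ^ q ^ i ∈ I :=
    Ideal.subset_span (by simp)
  have hB : (X 0 : MvPolynomial (Fin 2) K) ^ (u * (q - 1) + 1) - X 0 ∈ I :=
    Ideal.subset_span (by simp)
  constructor
  · intro hf
    set P : MvPolynomial (Fin 2) K := X 0 ^ u - ∑ i ∈ Finset.range r, X 1 ^ q ^ i with hP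
    have hQ : Fintype.card K - 1 ≠ 0 := by
      have := Fintype.one_lt_card (α := K)
      omega
    have key : f * (1 - P ^ (Fintype.card K - 1)) ∈ I := by
      refine nt_mem_of_vanish I ?_ _ ?_
      · intro i
        rw [hK]
        fin_cases i
        · exact I.mem_of_dvd (nt_dvd _ _ (by positivity) hu1 _) hB
        · have h1 := nt_trace_pow p k r (X 1 : MvPolynomial (Fin 2) K)
          rw [hq] at h1
          have h2 := huq (X 0 : MvPolynomial (Fin 2) K)
          set T : MvPolynomial (Fin 2) K := ∑ i ∈ Finset.range r, X 1 ^ q ^ i with hT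
          have h3 : P ∣ (X 0 ^ u) ^ q - T ^ q := sub_dvd_pow_sub_pow _ _ _
          have h4 : (X 1 : MvPolynomial (Fin 2) K) ^ q ^ r - X 1
              = X 0 ^ (u - 1) * (X 0 ^ (u * (q - 1) + 1) - X 0) - ((X 0 ^ u) ^ q - T ^ q) + P := by
            rw [← h1, ← h2, hP]
            ring
          change (X 1 : MvPolynomial (Fin 2) K) ^ q ^ r - X 1 ∈ I
          rw [h4]
          exact I.add_mem (I.sub_mem (I.mul_mem_left _ hB) (I.mem_of_dvd h3 hA)) hA
      · intro x
        by_cases hx : eval x P = 0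
        · have h1 : (x 0, x 1) ∈ ntCurve K q r u := by
            simpa [hP, ntCurve, sub_eq_zero] using hx
          have h2 := hf _ h1
          have h3 : ![x 0, x 1] = x := by
            ext i; fin_cases i <;> rfl
          simp only [h3] at h2
          simp [h2]
        · simp [FiniteField.pow_card_sub_one_eq_one _ hx]
    have h5 : f = f * (1 - P ^ (Fintype.card K - 1)) + f * P ^ (Fintype.card K - 1) := by ring
    rw [h5]
    exact I.add_mem key (I.mul_mem_left _ (I.pow_mem_of_mem hA _ (Nat.pos_of_ne_zero hQ)))
  · intro hf Q hQ
    have hle : I ≤ RingHom.ker (eval ![Q.1, Q.2]) := by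
      rw [hI, Ideal.span_le]
      have hQ' : Q.1 ^ u = ∑ i ∈ Finset.range r, Q.2 ^ q ^ i := hQ
      rintro g (rfl | rfl)
      · simp [RingHom.mem_ker, hQ']
      · have h1 := nt_trace_pow p k r Q.2
        rw [hq, ← hQ', huq, ← hK, FiniteField.pow_card, sub_self] at h1
        simp only [SetLike.mem_coe, RingHom.mem_ker, map_sub, map_pow, eval_X,
          Matrix.cons_val_zero]
        rcases mul_eq_zero.mp h1 with h | h
        · rw [eq_zero_of_pow_eq_zero h]
          simp
        · exact h
    exact hle hf
end

section
/- Let q be a prime power, r > 1, and u a divisor of (q^r−1)/(q−1), and let I ⊆ F_{q^r}[X,Y] be the ideal generated by X^u − Tr_{F_{q^r}/F_q}(Y) and X^{u(q−1)+1} − X. Then I is graded with respect to the (q^{r−1},u)-weight taken modulo (q−1)u: if f ∈ I and, for each residue class a modulo (q−1)u, f_a denotes the sum of the terms of f whose monomials X^iY^j satisfy q^{r−1} i + u j ≡ a (mod (q−1)u), then every f_a lies in I. -/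
open scoped BigOperators
open MvPolynomial

/-- The `(q^{r-1}, u)`-weight of the monomial `X^{m 0} Y^{m 1}`:
`ρ(X^i Y^j) = q^{r-1} i + u j`. -/
def ntWeight (q r u : ℕ) (m : Fin 2 →₀ ℕ) : ℕ :=
  q ^ (r - 1) * m 0 + u * m 1

/-- Let `q` be a prime power, `r > 1`, and `u` a positive divisor of `(q^r - 1)/(q - 1)`,
and let `I ⊆ F_{q^r}[X, Y]` be the ideal generated by `X^u - Tr_{F_{q^r}/F_q}(Y)` and
`X^{u(q-1)+1} - X`.  Then `I` is graded with respect to the `(q^{r-1}, u)`-weight taken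
modulo `(q-1)u`: if `f ∈ I` and `f_a` is the sum of the terms of `f` whose monomials have
`(q^{r-1}, u)`-weight congruent to `a` modulo `(q-1)u`, then `f_a ∈ I` for every `a`. -/
theorem graded_part_mem_ideal (q r u : ℕ) (hq : IsPrimePow q) (hr : 1 < r)
    (hu : 0 < u) (hdvd : u ∣ (q ^ r - 1) / (q - 1))
    (K : Type*) [Field K] [Fintype K] (hK : Fintype.card K = q ^ r)
    (f : MvPolynomial (Fin 2) K)
    (hf : f ∈ Ideal.span
        {(X 0 : MvPolynomial (Fin 2) K) ^ u - ∑ i ∈ Finset.range r, X 1 ^ q ^ i,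
         (X 0 : MvPolynomial (Fin 2) K) ^ (u * (q - 1) + 1) - X 0})
    (a : ℕ) :
    (∑ m ∈ f.support.filter (fun m => ntWeight q r u m % ((q - 1) * u) = a % ((q - 1) * u)),
        monomial m (f.coeff m))
      ∈ Ideal.span
        {(X 0 : MvPolynomial (Fin 2) K) ^ u - ∑ i ∈ Finset.range r, X 1 ^ q ^ i,
         (X 0 : MvPolynomial (Fin 2) K) ^ (u * (q - 1) + 1) - X 0} := by
  classical
  have hq1 : 1 ≤ q := hq.pos
  set N := (q - 1) * u with hN
  let w : Fin 2 → ZMod N := ![((q ^ (r - 1) : ℕ) : ZMod N), (u : ZMod N)]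
  have hw : ∀ m : Fin 2 →₀ ℕ, Finsupp.weight w m = ((ntWeight q r u m : ℕ) : ZMod N) := by
    intro m
    rw [Finsupp.weight_apply, Finsupp.sum_fintype _ _ (by simp)]
    simp [w, ntWeight, Fin.sum_univ_two, mul_comm]
  have hqu : (q : ZMod N) * u = u := by
    have h0 : (((q - 1) * u : ℕ) : ZMod N) = 0 := by rw [← hN]; exact ZMod.natCast_self N
    rw [Nat.cast_mul, Nat.cast_sub hq1] at h0
    linear_combination h0
  have hqi : ∀ i : ℕ, (q : ZMod N) ^ i * u = u := by
    intro i
    induction i with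
    | zero => simp
    | succ k ih => rw [pow_succ, mul_assoc, hqu, ih]
  have hX : ∀ i : Fin 2, IsWeightedHomogeneous w (X i : MvPolynomial (Fin 2) K) (w i) :=
    fun i => isWeightedHomogeneous_X K w i
  letI : GradedAlgebra (weightedHomogeneousSubmodule K w) := weightedGradedAlgebra K w
  have hhom : (Ideal.span
        {(X 0 : MvPolynomial (Fin 2) K) ^ u - ∑ i ∈ Finset.range r, X 1 ^ q ^ i,
         (X 0 : MvPolynomial (Fin 2) K) ^ (u * (q - 1) + 1) - X 0}).IsHomogeneous
         (weightedHomogeneousSubmodule K w) := by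
    apply Ideal.homogeneous_span
    rintro x (rfl | rfl)
    · refine ⟨(u : ZMod N), Submodule.sub_mem _ ?_ (Submodule.sum_mem _ fun i _ => ?_)⟩
      · have h := (hX 0).pow u
        have e : u • w 0 = (u : ZMod N) := by
          simp only [w, nsmul_eq_mul, Matrix.cons_val_zero, Nat.cast_pow]
          rw [mul_comm, hqi]
        rw [e] at h
        exact h
      · have h := (hX 1).pow (q ^ i)
        have e : (q ^ i) • w 1 = (u : ZMod N) := by
          simp only [w, nsmul_eq_mul, Matrix.cons_val_one, Nat.cast_pow]
          simpa using hqi i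
        rw [e] at h
        exact h
    · refine ⟨w 0, Submodule.sub_mem _ ?_ (hX 0)⟩
      have h := (hX 0).pow (u * (q - 1) + 1)
      have e : (u * (q - 1) + 1) • w 0 = w 0 := by
        rw [add_smul, one_smul, mul_comm u, ← hN, nsmul_eq_mul, ZMod.natCast_self]
        simp
      rw [e] at h
      exact h
  have key := hhom (a : ZMod N) hf
  have hk : ((DirectSum.decompose (weightedHomogeneousSubmodule K w) f (a : ZMod N) :
      weightedHomogeneousSubmodule K w (a : ZMod N)) : MvPolynomial (Fin 2) K) =
      weightedHomogeneousComponent w (a : ZMod N) f :=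
    weightedDecomposition.decompose'_apply K w f _
  rw [hk] at key
  convert key using 1
  rw [weightedHomogeneousComponent_apply]
  refine Finset.sum_congr (Finset.filter_congr fun m _ => ?_) fun _ _ => rfl
  rw [hw, ZMod.natCast_eq_natCast_iff]
  rfl
end

section
/- Let q be a prime power, r > 1, and u a divisor of (q^r−1)/(q−1). Let Δ := {X^iY^j : 0 ≤ i ≤ u(q−1), 0 ≤ j ≤ q^{r−1}−1}. Then the minimum Hamming distance of the extended Norm–Trace code NT_u(s) is at least min over monomials P with ρ(P) ≤ s of #{K ∈ Δ : there exists K' ∈ Δ with ρ(K') + ρ(P) = ρ(K)}, where ρ denotes the (q^{r−1},u)-weight. -/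
open scoped BigOperators

/-- The extended Norm--Trace code of weight `s`: the span of the evaluations at the
points `P 1, ..., P n` of the monomials `X^a Y^b` of `(q^{r-1}, u)`-weight
`q^{r-1} a + u b ≤ s`. -/
noncomputable def ntCode (K : Type*) [Field K] (q r u : ℕ) {n : ℕ}
    (P : Fin n → K × K) (s : ℤ) : Submodule K (Fin n → K) :=
  Submodule.span K
    {v | ∃ a b : ℕ, ((q : ℤ) ^ (r - 1) * a + (u : ℤ) * b ≤ s) ∧
      v = fun i => (P i).1 ^ a * (P i).2 ^ b}

/-- The set `Δ` of exponent pairs `(i, j)` of the monomials `X^i Y^j` with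
`0 ≤ i ≤ u(q-1)` and `0 ≤ j ≤ q^{r-1} - 1`. -/
def ntDelta (q r u : ℕ) : Finset (ℕ × ℕ) :=
  Finset.range (u * (q - 1) + 1) ×ˢ Finset.range (q ^ (r - 1))


namespace NTAux

/-- Evaluation of the monomial with exponents `m` at the points `(x i, y i)`. -/
def ev {K : Type*} [Field K] {n : ℕ} (x y : Fin n → K) (m : ℕ × ℕ) : Fin n → K :=
  fun i => x i ^ m.1 * y i ^ m.2

/-- The weight. -/
def rho (Q u : ℕ) (m : ℕ × ℕ) : ℕ := Q * m.1 + u * m.2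

/-- Span of the evaluations of monomials in `D` of weight less than `t`. -/
def low {K : Type*} [Field K] {n : ℕ} (x y : Fin n → K) (Q u : ℕ) (D : Finset (ℕ × ℕ))
    (t : ℕ) : Submodule K (Fin n → K) :=
  Submodule.span K (ev x y '' {k | k ∈ D ∧ rho Q u k < t})

lemma low_mono {K : Type*} [Field K] {n : ℕ} (x y : Fin n → K) (Q u : ℕ) (D : Finset (ℕ × ℕ))
    {t t' : ℕ} (h : t ≤ t') : low x y Q u D t ≤ low x y Q u D t' := by
  apply Submodule.span_mono
  apply Set.image_mono
  rintro k ⟨h1, h2⟩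
  exact ⟨h1, by omega⟩

lemma rho_inj {Q u : ℕ} (hc : Nat.Coprime Q u) {m k : ℕ × ℕ} (hm : m.2 < Q)
    (hk : k.2 < Q) (h : rho Q u m = rho Q u k) : m = k := by
  unfold rho at h
  have h1 : u * m.2 ≡ u * k.2 [MOD Q] := by
    have : Q * m.1 + u * m.2 ≡ Q * k.1 + u * k.2 [MOD Q] := by rw [h]
    simpa [Nat.ModEq, Nat.add_mod] using this
  have h2 : m.2 ≡ k.2 [MOD Q] := Nat.ModEq.cancel_left_of_coprime hc h1
  have h3 : m.2 = k.2 := by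
    rw [Nat.ModEq, Nat.mod_eq_of_lt hm, Nat.mod_eq_of_lt hk] at h2
    exact h2
  have h4 : Q * m.1 = Q * k.1 := by rw [h3] at h; omega
  have h5 : m.1 = k.1 := Nat.eq_of_mul_eq_mul_left (by omega) h4
  exact Prod.ext h5 h3

lemma red {K : Type*} [Field K] {n : ℕ} (x y : Fin n → K) (q r u : ℕ) (hq : 1 < q)
    (hr : 1 < r) (hu : 0 < u) (hc : Nat.Coprime (q ^ (r - 1)) u)
    (hT : ∀ i, x i ^ u = ∑ j ∈ Finset.range r, y i ^ q ^ j)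
    (hX : ∀ i, x i ^ (u * (q - 1) + 1) = x i) :
    ∀ (t d : ℕ) (m : ℕ × ℕ), rho (q ^ (r - 1)) u m = t → m.2 = d →
      ev x y m ∈ low x y (q ^ (r - 1)) u (ntDelta q r u) (t + 1) ∧
      ∀ k ∈ ntDelta q r u, rho (q ^ (r - 1)) u k = t →
        ev x y m - ev x y k ∈ low x y (q ^ (r - 1)) u (ntDelta q r u) t := by
  intro t
  induction t using Nat.strong_induction_on with
  | _ t iht =>
  intro d
  induction d using Nat.strong_induction_on with
  | _ d ihd =>
  rintro ⟨a, b⟩ hm hd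
  simp only at hd
  subst hd
  have hQ : 0 < q ^ (r - 1) := by positivity
  have hred : ∀ m' : ℕ × ℕ, rho (q ^ (r - 1)) u m' < t →
      ev x y m' ∈ low x y (q ^ (r - 1)) u (ntDelta q r u) t := by
    intro m' h
    exact low_mono _ _ _ _ _ (by omega) (iht _ h _ m' rfl rfl).1
  by_cases hb : q ^ (r - 1) ≤ b
  · obtain ⟨c, rfl⟩ := Nat.exists_eq_add_of_le hb
    have key : ev x y (a, q ^ (r - 1) + c) = ev x y (a + u, c) -
        ∑ j ∈ Finset.range (r - 1), ev x y (a, q ^ j + c) := by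
      funext i
      have h := hT i
      obtain ⟨r', rfl⟩ : ∃ r', r = r' + 1 := ⟨r - 1, by omega⟩
      rw [Finset.sum_range_succ] at h
      simp only [ev, Pi.sub_apply, Finset.sum_apply, Nat.add_sub_cancel]
      have h2 : ∑ j ∈ Finset.range r', x i ^ a * y i ^ (q ^ j + c)
          = x i ^ a * y i ^ c * ∑ j ∈ Finset.range r', y i ^ q ^ j := by
        rw [Finset.mul_sum]
        refine Finset.sum_congr rfl fun j _ => ?_
        ring
      rw [h2, pow_add (x i) a u, h]
      ring
    have hs : ∑ j ∈ Finset.range (r - 1), ev x y (a, q ^ j + c) ∈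
        low x y (q ^ (r - 1)) u (ntDelta q r u) t := by
      apply Submodule.sum_mem
      intro j hj
      apply hred
      rw [← hm]
      have : q ^ j < q ^ (r - 1) := Nat.pow_lt_pow_right hq (Finset.mem_range.mp hj)
      simp only [rho]
      have := Nat.mul_lt_mul_of_pos_left this hu
      nlinarith
    obtain ⟨i1, i2⟩ := ihd c (by omega) (a + u, c) (by rw [← hm]; simp only [rho]; ring) rfl
    rw [key]
    refine ⟨Submodule.sub_mem _ i1 (low_mono _ _ _ _ _ (by omega) hs), ?_⟩
    intro k hk hkt
    rw [sub_right_comm]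
    exact Submodule.sub_mem _ (i2 k hk hkt) hs
  · push Not at hb
    have huniq : ∀ k ∈ ntDelta q r u, rho (q ^ (r - 1)) u k = t → k = (a, b) := by
      intro k hk hkt
      apply rho_inj hc _ hb (hkt.trans hm.symm)
      simp only [ntDelta, Finset.mem_product, Finset.mem_range] at hk
      exact hk.2
    by_cases ha : a < u * (q - 1) + 1
    · have hmem : (a, b) ∈ ntDelta q r u := by
        simp only [ntDelta, Finset.mem_product, Finset.mem_range]
        exact ⟨ha, hb⟩
      refine ⟨Submodule.subset_span ⟨(a, b), ⟨hmem, by omega⟩, rfl⟩, ?_⟩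
      intro k hk hkt
      rw [huniq k hk hkt, sub_self]
      exact Submodule.zero_mem _
    · obtain ⟨c, rfl⟩ := Nat.exists_eq_add_of_le (not_lt.mp ha)
      have key : ev x y (u * (q - 1) + 1 + c, b) = ev x y (1 + c, b) := by
        funext i
        simp only [ev]
        rw [pow_add, hX i, pow_add, pow_one]
      have hlt : rho (q ^ (r - 1)) u (1 + c, b) < t := by
        rw [← hm]
        simp only [rho]
        have h1 : 0 < u * (q - 1) := Nat.mul_pos hu (by omega)
        have := Nat.mul_lt_mul_of_pos_left (show 1 + c < u * (q - 1) + 1 + c by omega) hQ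
        omega
      rw [key]
      refine ⟨low_mono _ _ _ _ _ (by omega) (hred _ hlt), ?_⟩
      intro k hk hkt
      have := huniq k hk hkt
      subst this
      simp only [ntDelta, Finset.mem_product, Finset.mem_range] at hk
      omega

lemma ev_span {K : Type*} [Field K] [Fintype K] {n : ℕ} (x y : Fin n → K)
    (hinj : ∀ i j, x i = x j → y i = y j → i = j) (W : Submodule K (Fin n → K))
    (hW : ∀ m, ev x y m ∈ W) : W = ⊤ := by
  classical
  have hpoly : ∀ f g : Polynomial K, (fun i => f.eval (x i) * g.eval (y i)) ∈ W := by
    intro f g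
    have : (fun i => f.eval (x i) * g.eval (y i)) =
        ∑ a ∈ Finset.range (f.natDegree + 1), ∑ b ∈ Finset.range (g.natDegree + 1),
          (f.coeff a * g.coeff b) • ev x y (a, b) := by
      funext i
      simp only [Finset.sum_apply, Pi.smul_apply, smul_eq_mul, ev]
      rw [Polynomial.eval_eq_sum_range, Polynomial.eval_eq_sum_range, Finset.sum_mul_sum]
      refine Finset.sum_congr rfl fun a _ => Finset.sum_congr rfl fun b _ => ?_
      ring
    rw [this]
    exact Submodule.sum_mem _ fun a _ => Submodule.sum_mem _ fun b _ =>
      Submodule.smul_mem _ _ (hW _)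
  have hd : ∀ z w : K, (1 - (Polynomial.X - Polynomial.C z) ^ (Fintype.card K - 1) :
      Polynomial K).eval w = if w = z then 1 else 0 := by
    intro z w
    have h1 : Fintype.card K - 1 ≠ 0 := by
      have := Fintype.one_lt_card (α := K)
      omega
    simp only [Polynomial.eval_sub, Polynomial.eval_one, Polynomial.eval_pow, Polynomial.eval_X,
      Polynomial.eval_C]
    split_ifs with h
    · rw [h, sub_self, zero_pow h1, sub_zero]
    · rw [FiniteField.pow_card_sub_one_eq_one _ (sub_ne_zero.mpr h), sub_self]
  rw [eq_top_iff]
  intro f _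
  have hf : f = ∑ i, f i • (Pi.single i 1 : Fin n → K) := by
    funext j
    simp [Finset.sum_apply, Pi.single_apply]
  rw [hf]
  refine Submodule.sum_mem _ fun i _ => Submodule.smul_mem _ _ ?_
  have := hpoly (1 - (Polynomial.X - Polynomial.C (x i)) ^ (Fintype.card K - 1))
    (1 - (Polynomial.X - Polynomial.C (y i)) ^ (Fintype.card K - 1))
  convert this using 1
  funext j
  rw [hd, hd, Pi.single_apply]
  by_cases h : j = i
  · subst h; simp
  · rw [if_neg h]
    by_cases h1 : x j = x i
    · have h2 : y j ≠ y i := fun h2 => h (hinj _ _ h1 h2)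
      simp [h2]
    · simp [h1]

/-- Triangular families are independent. -/
lemma tri {K V ι κ : Type*} [Field K] [AddCommGroup V] [Module K V] [Fintype ι]
    (E : κ → V) (D : Finset κ) (hE : LinearIndependent K (fun k : D => E k)) (w : κ → ℕ)
    (f : ι → κ) (hf : ∀ i, f i ∈ D) (hw : Function.Injective (fun i => w (f i)))
    (α : K) (hα : α ≠ 0) (v : ι → V)
    (hv : ∀ i, v i - α • E (f i) ∈ Submodule.span K (E '' {k | k ∈ D ∧ w k < w (f i)})) :
    LinearIndependent K v := by
  classical
  rw [Fintype.linearIndependent_iff]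
  intro g hg
  by_contra hne
  push Not at hne
  obtain ⟨i0, hi0⟩ := hne
  obtain ⟨i, hi, hmax⟩ := Finset.exists_max_image (Finset.univ.filter fun i => g i ≠ 0)
    (fun i => w (f i)) ⟨i0, by simpa using hi0⟩
  have hgi : g i ≠ 0 := by simpa using hi
  set L := Submodule.span K (E '' {k | k ∈ D ∧ w k < w (f i)}) with hL
  have hother : ∀ j, j ≠ i → g j • v j ∈ L := by
    intro j hj
    by_cases hgj : g j = 0
    · rw [hgj, zero_smul]; exact L.zero_mem
    · have h1 : w (f j) ≤ w (f i) := hmax j (by simpa using hgj)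
      have h2 : w (f j) ≠ w (f i) := fun h => hj (hw h)
      have h3 : w (f j) < w (f i) := lt_of_le_of_ne h1 h2
      apply L.smul_mem
      have h4 : v j - α • E (f j) ∈ L := by
        refine Submodule.span_mono (Set.image_mono ?_) (hv j)
        rintro k ⟨a, b⟩
        exact ⟨a, b.trans h3⟩
      have h5 : E (f j) ∈ L := Submodule.subset_span ⟨f j, ⟨hf j, h3⟩, rfl⟩
      have := L.add_mem h4 (L.smul_mem α h5)
      simpa using this
  have hgv : g i • v i ∈ L := by
    rw [← Finset.add_sum_erase _ _ (Finset.mem_univ i)] at hg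
    rw [eq_neg_of_add_eq_zero_left hg]
    exact L.neg_mem (L.sum_mem fun j hj => hother j (Finset.ne_of_mem_erase hj))
  have hvi : v i ∈ L := by
    have := L.smul_mem (g i)⁻¹ hgv
    rwa [smul_smul, inv_mul_cancel₀ hgi, one_smul] at this
  have hEi : E (f i) ∈ L := by
    have h1 := L.sub_mem hvi (hv i)
    rw [sub_sub_cancel] at h1
    have := L.smul_mem α⁻¹ h1
    rwa [smul_smul, inv_mul_cancel₀ hα, one_smul] at this
  have := hE.notMem_span_image (s := {k : D | w k < w (f i)}) (x := ⟨f i, hf i⟩) (by simp)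
  apply this
  convert hEi using 1
  rw [hL]
  congr 1
  ext z
  constructor
  · rintro ⟨⟨k, hk⟩, h1, rfl⟩
    exact ⟨k, ⟨hk, h1⟩, rfl⟩
  · rintro ⟨k, ⟨hk, h1⟩, rfl⟩
    exact ⟨⟨k, hk⟩, h1, rfl⟩

lemma card_le_supp {K ι : Type*} [Field K] [Fintype ι] {n : ℕ} (c : Fin n → K)
    (g : ι → Fin n → K) (h : LinearIndependent K (fun i => c * g i)) :
    Fintype.card ι ≤ {i | c i ≠ 0}.ncard := by
  classical
  let M : ({i // c i ≠ 0} → K) →ₗ[K] (Fin n → K) :=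
    { toFun := fun f i => if h : c i ≠ 0 then c i * f ⟨i, h⟩ else 0
      map_add' := by
        intro f g
        funext i
        by_cases h : c i = 0 <;> simp [h, mul_add]
      map_smul' := by
        intro a f
        funext i
        by_cases h : c i = 0
        · simp [h]
        · simp [h, mul_left_comm] }
  have h1 : LinearIndependent K (fun i (j : {i // c i ≠ 0}) => g i j) := by
    apply LinearIndependent.of_comp M
    convert h using 1
    funext i j
    by_cases h : c j = 0 <;> simp [M, h]
  have h2 := h1.fintype_card_le_finrank
  rw [Module.finrank_fintype_fun_eq_card] at h2
  rw [← Nat.card_coe_set_eq]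
  change _ ≤ Nat.card {i // c i ≠ 0}
  rw [Nat.card_eq_fintype_card]
  exact h2

lemma frob {K : Type*} [Field K] [Fintype K] (q r : ℕ) (hq : IsPrimePow q) (hr : 1 < r)
    (hK : Fintype.card K = q ^ r) (y : K) :
    (∑ j ∈ Finset.range r, y ^ q ^ j) ^ q = ∑ j ∈ Finset.range r, y ^ q ^ j := by
  obtain ⟨p, k, hp, hk, rfl⟩ := hq
  have hp' : p.Prime := hp.nat_prime
  obtain ⟨p', hchar⟩ := CharP.exists K
  obtain ⟨m, hp2, hm⟩ := FiniteField.card K p'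
  have hpp : p = p' := by
    have h1 : p ∣ p' ^ (m : ℕ) := by
      rw [← hm, hK, ← pow_mul]
      exact dvd_pow_self _ (Nat.mul_ne_zero (by omega) (by omega))
    exact (Nat.prime_dvd_prime_iff_eq hp' hp2).mp (hp'.dvd_of_dvd_pow h1)
  subst hpp
  have := Fact.mk hp'
  rw [sum_pow_char_pow]
  obtain ⟨r', rfl⟩ : ∃ r', r = r' + 1 := ⟨r - 1, by omega⟩
  rw [Finset.sum_range_succ, Finset.sum_range_succ']
  have hy : y ^ (p ^ k) ^ (r' + 1) = y := by rw [← hK]; exact FiniteField.pow_card y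
  congr 1
  · refine Finset.sum_congr rfl fun j _ => ?_
    rw [← pow_mul, ← pow_succ]
  · rw [← pow_mul, ← pow_succ, hy, pow_zero, pow_one]

lemma fiber_le {K : Type*} [Field K] [Fintype K] [DecidableEq K] (q r : ℕ) (hq : 1 < q)
    (hr : 1 < r) (a : K) :
    (Finset.univ.filter fun y : K => ∑ j ∈ Finset.range r, y ^ q ^ j = a).card
      ≤ q ^ (r - 1) := by
  set P : Polynomial K := ∑ j ∈ Finset.range r, Polynomial.X ^ q ^ j - Polynomial.C a with hP
  have hdeg : P.natDegree ≤ q ^ (r - 1) := by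
    rw [hP]
    apply (Polynomial.natDegree_sub_C).le.trans
    apply Polynomial.natDegree_sum_le_of_forall_le
    intro j hj
    rw [Polynomial.natDegree_X_pow]
    have := Finset.mem_range.mp hj
    exact Nat.pow_le_pow_right (by omega) (by omega)
  have hne : P ≠ 0 := by
    intro h0
    have h1 : P.coeff (q ^ (r - 1)) = 1 := by
      rw [hP, Polynomial.coeff_sub, Polynomial.finsetSum_coeff, Polynomial.coeff_C,
        if_neg (by positivity), sub_zero]
      rw [Finset.sum_eq_single (r - 1)]
      · simp
      · intro j _ hj
        rw [Polynomial.coeff_X_pow, if_neg]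
        intro h
        exact hj (Nat.pow_right_injective hq h).symm
      · intro h
        exact absurd (Finset.mem_range.mpr (by omega)) h
    rw [h0] at h1
    simp at h1
  calc _ ≤ P.roots.toFinset.card := by
        apply Finset.card_le_card
        intro y hy
        have hy' := (Finset.mem_filter.mp hy).2
        rw [Multiset.mem_toFinset, Polynomial.mem_roots hne, Polynomial.IsRoot, hP]
        simp [Polynomial.eval_finsetSum, hy']
    _ ≤ P.roots.card := Multiset.toFinset_card_le _
    _ ≤ P.natDegree := Polynomial.card_roots' _
    _ ≤ _ := hdeg

lemma fiber_eq {K : Type*} [Field K] [Fintype K] [DecidableEq K] (q r : ℕ) (hq : IsPrimePow q)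
    (hr : 1 < r) (hK : Fintype.card K = q ^ r) (a : K) (ha : a ^ q = a) :
    (Finset.univ.filter fun y : K => ∑ j ∈ Finset.range r, y ^ q ^ j = a).card
      = q ^ (r - 1) := by
  have hq1 : 1 < q := hq.one_lt
  apply le_antisymm (fiber_le q r hq1 hr a)
  by_contra hlt
  push Not at hlt
  set F : Finset K := Finset.univ.filter fun a => a ^ q = a with hF
  have hFc : F.card ≤ q := by
    have hne := FiniteField.X_pow_card_sub_X_ne_zero K hq1
    calc F.card ≤ (Polynomial.X ^ q - Polynomial.X : Polynomial K).roots.toFinset.card := by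
          apply Finset.card_le_card
          intro y hy
          have hy' := (Finset.mem_filter.mp hy).2
          rw [Multiset.mem_toFinset, Polynomial.mem_roots hne, Polynomial.IsRoot]
          simp [hy']
      _ ≤ _ := Multiset.toFinset_card_le _
      _ ≤ _ := Polynomial.card_roots' _
      _ = q := FiniteField.X_pow_card_sub_X_natDegree_eq K hq1
  have h1 : (Finset.univ : Finset K).card = ∑ b ∈ F,
      (Finset.univ.filter fun y : K => ∑ j ∈ Finset.range r, y ^ q ^ j = b).card := by
    apply Finset.card_eq_sum_card_fiberwise
    intro y _
    simpa [hF] using frob q r hq hr hK y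
  have h2 : ∑ b ∈ F, (Finset.univ.filter fun y : K => ∑ j ∈ Finset.range r, y ^ q ^ j = b).card
      < ∑ _b ∈ F, q ^ (r - 1) := by
    apply Finset.sum_lt_sum (fun b _ => fiber_le q r hq1 hr b)
    exact ⟨a, by simpa [hF] using ha, hlt⟩
  rw [← h1, Finset.card_univ, hK, Finset.sum_const, smul_eq_mul] at h2
  have h3 := Nat.mul_le_mul_right (q ^ (r - 1)) hFc
  rw [← pow_succ', Nat.sub_add_cancel (by omega)] at h3
  omega

lemma dvd_aux (q r u : ℕ) (hq : 1 < q) (hdvd : u ∣ (q ^ r - 1) / (q - 1)) :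
    u * (q - 1) ∣ q ^ r - 1 := by
  have h : q - 1 ∣ q ^ r - 1 := by simpa using Nat.sub_dvd_pow_sub_pow q 1 r
  obtain ⟨c, hc⟩ := h
  rw [hc, Nat.mul_div_cancel_left _ (by omega)] at hdvd
  rw [hc, mul_comm]
  exact Nat.mul_dvd_mul_left _ hdvd

lemma x_count {K : Type*} [Field K] [Fintype K] [DecidableEq K] (N : ℕ) (hN : 0 < N)
    (hd : N ∣ Fintype.card K - 1) :
    N + 1 ≤ (Finset.univ.filter fun x : K => x ^ (N + 1) = x).card := by
  have h1 : (Finset.univ.filter fun g : Kˣ => g ^ N = 1).card = N := by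
    rw [← sum_card_orderOf_eq_card_pow_eq_one hN.ne']
    conv_rhs => rw [← Nat.sum_totient N]
    refine Finset.sum_congr rfl fun m hm => ?_
    apply IsCyclic.card_orderOf_eq_totient
    have := (Nat.dvd_of_mem_divisors hm).trans hd
    rw [← Fintype.card_units] at this
    simpa using this
  have h2 : (insert (0 : K) ((Finset.univ.filter fun g : Kˣ => g ^ N = 1).map
      ⟨Units.val, Units.val_injective⟩)).card = N + 1 := by
    rw [Finset.card_insert_of_notMem, Finset.card_map, h1]
    simp
  refine h2.symm.le.trans ?_
  apply Finset.card_le_card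
  intro z hz
  rw [Finset.mem_insert] at hz
  rw [Finset.mem_filter]
  refine ⟨Finset.mem_univ _, ?_⟩
  rcases hz with rfl | hz
  · simp
  · obtain ⟨g, hg, rfl⟩ := Finset.mem_map.mp hz
    have := (Finset.mem_filter.mp hg).2
    simp only [Function.Embedding.coeFn_mk]
    rw [pow_succ, ← Units.val_pow_eq_pow_val, this]
    simp

lemma n_ge {K : Type*} [Field K] [Fintype K] (q r u : ℕ) (hq : IsPrimePow q) (hr : 1 < r)
    (hu : 0 < u) (hdvd : u ∣ (q ^ r - 1) / (q - 1)) (hK : Fintype.card K = q ^ r)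
    (n : ℕ) (e : Fin n ≃ ↥(ntCurve K q r u)) : (ntDelta q r u).card ≤ n := by
  classical
  have hq1 : 1 < q := hq.one_lt
  set X : Finset K := Finset.univ.filter fun x : K => x ^ (u * (q - 1) + 1) = x with hXd
  have hX : u * (q - 1) + 1 ≤ X.card :=
    x_count _ (Nat.mul_pos hu (by omega)) (hK ▸ dvd_aux q r u hq1 hdvd)
  set S : Finset (Σ _ : K, K) := X.sigma fun x => Finset.univ.filter fun y : K =>
    ∑ j ∈ Finset.range r, y ^ q ^ j = x ^ u with hS
  have hSc : S.card = X.card * q ^ (r - 1) := by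
    rw [hS, Finset.card_sigma, Finset.sum_const_nat]
    intro x hx
    apply fiber_eq q r hq hr hK
    have hx' := (Finset.mem_filter.mp hx).2
    obtain ⟨q', rfl⟩ : ∃ q', q = q' + 1 := ⟨q - 1, by omega⟩
    obtain ⟨u', rfl⟩ : ∃ u', u = u' + 1 := ⟨u - 1, by omega⟩
    rw [Nat.add_sub_cancel] at hx'
    calc (x ^ (u' + 1)) ^ (q' + 1) = x ^ ((u' + 1) * q' + 1) * x ^ u' := by ring
      _ = x ^ (u' + 1) := by rw [hx']; ring
  have hle : S.card ≤ n := by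
    have : Fintype.card S ≤ Fintype.card (Fin n) := by
      apply Fintype.card_le_of_injective (fun s : S => e.symm ⟨(s.1.1, s.1.2), by
        have := (Finset.mem_sigma.mp s.2).2
        exact (Finset.mem_filter.mp this).2.symm⟩)
      rintro ⟨⟨a, b⟩, h1⟩ ⟨⟨c, d⟩, h2⟩ h
      have := e.symm.injective h
      simp only [Subtype.mk.injEq, Prod.mk.injEq] at this
      obtain ⟨rfl, rfl⟩ := this
      rfl
    simpa using this
  rw [ntDelta, Finset.card_product, Finset.card_range, Finset.card_range]
  calc _ ≤ X.card * q ^ (r - 1) := Nat.mul_le_mul_right _ hX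
    _ = S.card := hSc.symm
    _ ≤ n := hle

lemma leading {K : Type*} [Field K] {n : ℕ} (x y : Fin n → K) (Q u : ℕ) (D : Finset (ℕ × ℕ))
    (hinj : ∀ k ∈ D, ∀ k' ∈ D, rho Q u k = rho Q u k' → k = k') (t : ℕ) (c : Fin n → K)
    (hc : c ∈ low x y Q u D t) (h0 : c ≠ 0) :
    ∃ k ∈ D, rho Q u k < t ∧ ∃ α : K, α ≠ 0 ∧ c - α • ev x y k ∈ low x y Q u D (rho Q u k) := by
  induction t with
  | zero =>
    exfalso
    apply h0
    simpa [low] using hc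
  | succ t ih =>
    by_cases h : c ∈ low x y Q u D t
    · obtain ⟨k, hk, hkt, h'⟩ := ih h
      exact ⟨k, hk, by omega, h'⟩
    · by_cases hk : ∃ k ∈ D, rho Q u k = t
      · obtain ⟨k, hk, rfl⟩ := hk
        have hle : low x y Q u D (rho Q u k + 1) ≤
            low x y Q u D (rho Q u k) ⊔ Submodule.span K {ev x y k} := by
          apply Submodule.span_le.mpr
          rintro _ ⟨j, ⟨hj, hjt⟩, rfl⟩
          by_cases hjk : rho Q u j = rho Q u k
          · rw [hinj j hj k hk hjk]
            exact Submodule.mem_sup_right (Submodule.mem_span_singleton_self _)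
          · exact Submodule.mem_sup_left (Submodule.subset_span ⟨j, ⟨hj, by omega⟩, rfl⟩)
        obtain ⟨l, hl, z, hz, hlz⟩ := Submodule.mem_sup.mp (hle hc)
        obtain ⟨α, rfl⟩ := Submodule.mem_span_singleton.mp hz
        refine ⟨k, hk, by omega, α, ?_, ?_⟩
        · rintro rfl
          apply h
          rw [← hlz]
          simpa using hl
        · rw [← hlz]
          simpa using hl
      · exfalso
        apply h
        refine Submodule.span_mono (Set.image_mono ?_) hc
        rintro k ⟨h1, h2⟩
        refine ⟨h1, ?_⟩
        have : rho Q u k ≠ t := fun h3 => hk ⟨k, h1, h3⟩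
        omega

end NTAux

/-- **Geil's bound.** Let `q` be a prime power, `r > 1`, `u` a positive divisor of
`(q^r - 1)/(q - 1)`, and let `P 1, ..., P n` be the points of the extended Norm--Trace
curve in some order.  The minimum Hamming distance of `NT_u(s)` is at least the minimum,
over the monomials `X^a Y^b` with `ρ(X^a Y^b) ≤ s`, of the number of `km ∈ Δ` such that
`ρ(km') + ρ(X^a Y^b) = ρ(km)` for some `km' ∈ Δ`, where `ρ(X^i Y^j) = q^{r-1} i + u j`. -/
theorem ntCode_minDist_bound (q r u : ℕ) (hq : IsPrimePow q) (hr : 1 < r)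
    (hu : 0 < u) (hdvd : u ∣ (q ^ r - 1) / (q - 1))
    (K : Type*) [Field K] [Fintype K] (hK : Fintype.card K = q ^ r)
    (n : ℕ) (e : Fin n ≃ ↥(ntCurve K q r u)) (s : ℤ) :
    ∀ c ∈ ntCode K q r u (fun i => ((e i : K × K))) s, c ≠ 0 →
      sInf {N : ℕ | ∃ a b : ℕ, ((q : ℤ) ^ (r - 1) * a + (u : ℤ) * b ≤ s) ∧
          N = ((ntDelta q r u).filter (fun km => ∃ km' ∈ ntDelta q r u,
              q ^ (r - 1) * km'.1 + u * km'.2 + (q ^ (r - 1) * a + u * b)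
                = q ^ (r - 1) * km.1 + u * km.2)).card}
        ≤ hammingWt c := by
  classical
  intro c hc hc0
  have hq1 : 1 < q := hq.one_lt
  set x : Fin n → K := fun i => (e i : K × K).1 with hx
  set y : Fin n → K := fun i => (e i : K × K).2 with hy
  set Q := q ^ (r - 1) with hQ
  set D := ntDelta q r u with hD
  have hT : ∀ i, x i ^ u = ∑ j ∈ Finset.range r, y i ^ q ^ j := fun i => (e i).2
  have hX : ∀ i, x i ^ (u * (q - 1) + 1) = x i := by
    intro i
    by_cases h0 : x i = 0
    · rw [h0]; simp
    have h1 : (x i ^ u) ^ q = x i ^ u := by rw [hT]; exact NTAux.frob q r hq hr hK _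
    obtain ⟨q', rfl⟩ : ∃ q', q = q' + 1 := ⟨q - 1, by omega⟩
    rw [Nat.add_sub_cancel]
    rw [pow_succ, ← pow_mul] at h1
    have h2 : x i ^ (u * q') = 1 := mul_right_cancel₀ (pow_ne_zero u h0) (h1.trans (one_mul _).symm)
    rw [pow_succ, h2, one_mul]
  have hcop : Nat.Coprime Q u := by
    have h1 : u ∣ q ^ r - 1 := (Dvd.intro _ rfl).trans (NTAux.dvd_aux q r u hq1 hdvd)
    have h2 : Nat.Coprime (q ^ r) (q ^ r - 1) := by
      have : 0 < q ^ r := by positivity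
      rw [Nat.coprime_self_sub_right (by omega)]
      simp
    exact (h2.coprime_dvd_right h1).coprime_dvd_left (pow_dvd_pow q (by omega))
  have hred := fun m => NTAux.red x y q r u hq1 hr hu hcop hT hX _ _ m rfl rfl
  have hDinj : ∀ k ∈ D, ∀ k' ∈ D, NTAux.rho Q u k = NTAux.rho Q u k' → k = k' := by
    intro k hk k' hk' h
    simp only [hD, ntDelta, Finset.mem_product, Finset.mem_range] at hk hk'
    exact NTAux.rho_inj hcop hk.2 hk'.2 h
  have hspan : Submodule.span K (Set.range fun k : D => NTAux.ev x y k) = ⊤ := by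
    apply NTAux.ev_span x y
    · intro i j h1 h2
      apply e.injective
      exact Subtype.ext (Prod.ext h1 h2)
    · intro m
      refine Submodule.span_mono ?_ (hred m).1
      rintro _ ⟨k, ⟨hk, _⟩, rfl⟩
      exact ⟨⟨k, hk⟩, rfl⟩
  have hind : LinearIndependent K (fun k : D => NTAux.ev x y k) := by
    have hle : D.card ≤ n := NTAux.n_ge q r u hq hr hu hdvd hK n e
    have hge : n ≤ D.card := by
      have := finrank_range_le_card (R := K) (fun k : D => NTAux.ev x y k)
      rw [Set.finrank, hspan, finrank_top] at this
      simpa using this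
    apply linearIndependent_of_top_le_span_of_card_eq_finrank hspan.ge
    simp
    omega
  have hclow : c ∈ NTAux.low x y Q u D (s + 1).toNat := by
    refine Submodule.span_le.mpr ?_ hc
    rintro _ ⟨a, b, hab, rfl⟩
    have h1 : NTAux.rho Q u (a, b) + 1 ≤ (s + 1).toNat := by
      have : ((NTAux.rho Q u (a, b) : ℕ) : ℤ) ≤ s := by
        simp only [NTAux.rho, hQ]
        push_cast
        exact hab
      omega
    exact NTAux.low_mono _ _ _ _ _ h1 (hred (a, b)).1
  obtain ⟨p, hp, hps, α, hα, hlead⟩ := NTAux.leading x y Q u D hDinj _ c hclow hc0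
  have hps' : (q : ℤ) ^ (r - 1) * p.1 + (u : ℤ) * p.2 ≤ s := by
    have : ((NTAux.rho Q u p : ℕ) : ℤ) ≤ s := by omega
    simp only [NTAux.rho, hQ] at this
    push_cast at this
    exact this
  set S := D.filter (fun km => ∃ km' ∈ D,
    Q * km'.1 + u * km'.2 + (Q * p.1 + u * p.2) = Q * km.1 + u * km.2) with hS
  have hex : ∀ k : S, ∃ k' ∈ D, NTAux.rho Q u k' + NTAux.rho Q u p = NTAux.rho Q u k.1 :=
    fun k => (Finset.mem_filter.mp k.2).2
  choose g hgD hg using hex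
  have hmul : ∀ m m' : ℕ × ℕ, NTAux.ev x y m * NTAux.ev x y m' = NTAux.ev x y (m + m') := by
    intro m m'
    funext i
    simp only [NTAux.ev, Pi.mul_apply, Prod.fst_add, Prod.snd_add, pow_add]
    ring
  have hrho : ∀ m m' : ℕ × ℕ, NTAux.rho Q u (m + m') = NTAux.rho Q u m + NTAux.rho Q u m' := by
    intro m m'
    simp only [NTAux.rho, Prod.fst_add, Prod.snd_add]
    ring
  have hlowmul : ∀ (m : ℕ × ℕ) (t : ℕ), ∀ l ∈ NTAux.low x y Q u D t,
      l * NTAux.ev x y m ∈ NTAux.low x y Q u D (t + NTAux.rho Q u m) := by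
    intro m t l hl
    have : NTAux.low x y Q u D t ≤ (NTAux.low x y Q u D (t + NTAux.rho Q u m)).comap
        (LinearMap.mulRight K (NTAux.ev x y m)) := by
      apply Submodule.span_le.mpr
      rintro _ ⟨k, ⟨_, hk⟩, rfl⟩
      simp only [Submodule.comap_coe, Set.mem_preimage, LinearMap.mulRight_apply, hmul]
      refine NTAux.low_mono _ _ _ _ _ ?_ (hred (k + m)).1
      rw [hrho]
      omega
    exact this hl
  have hli : LinearIndependent K (fun k : S => c * NTAux.ev x y (g k)) := by
    refine NTAux.tri (NTAux.ev x y) D hind (NTAux.rho Q u) (fun k : S => k.1)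
      (fun k => (Finset.mem_filter.mp k.2).1) ?_ α hα _ ?_
    · intro k k' h
      exact Subtype.ext (hDinj _ (Finset.mem_filter.mp k.2).1 _ (Finset.mem_filter.mp k'.2).1 h)
    · intro k
      have h1 := hlowmul (g k) _ _ hlead
      rw [add_comm, hg k, sub_mul, smul_mul_assoc, hmul] at h1
      have h2 := (hred (p + g k)).2 k.1 (Finset.mem_filter.mp k.2).1
        (by rw [hrho, add_comm]; exact (hg k).symm)
      rw [hrho, add_comm (NTAux.rho _ u p), hg k] at h2
      have h3 := Submodule.add_mem _ h1 (Submodule.smul_mem _ α h2)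
      rw [smul_sub, sub_add_sub_cancel] at h3
      exact h3
  have hfin := NTAux.card_le_supp c (fun k : S => NTAux.ev x y (g k)) hli
  rw [Fintype.card_coe] at hfin
  refine le_trans (Nat.sInf_le (m := S.card) ?_) hfin
  refine ⟨p.1, p.2, hps', ?_⟩
  rw [hS]
end

section
/- For q = 2, r = 4, u = 3 (so the curve x^3 = y + y^2 + y^4 + y^8 over F_16 has 32 points), the trace code Tr_{F_16/F_2}(NT_3(8)) has F_2-dimension 7; equivalently, the evaluations on NT_3 of the seven polynomials 1, Y, Y^2, Y^4, X, X^2, X^3 form an F_2-basis region spanning it, since X^4 ≡ X, X^8 ≡ X^2 and Y^8 ≡ X^3 + Y^4 + Y^2 + Y modulo the vanishing ideal of NT_3. -/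
open scoped BigOperators

/-- For `q = 2`, `r = 4`, `u = 3` (the curve `x^3 = y + y^2 + y^4 + y^8` over `F_16`,
which has `32` points), the trace code `Tr_{F_16/F_2}(NT_3(8))` has `F_2`-dimension `7`. -/
theorem finrank_traceCode_ntCode_three_eight
    (K F : Type*) [Field K] [Fintype K] [Field F] [Fintype F] [Algebra F K]
    (hK : Fintype.card K = 16) (hF : Fintype.card F = 2)
    (e : Fin 32 ≃ ↥(ntCurve K 2 4 3)) :
    Module.finrank F (traceCode F (ntCode K 2 4 3 (fun i => ((e i : K × K))) 8)) = 7 := by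
  classical
  have hfr : Module.finrank F K = 4 := by
    have h := Module.card_eq_pow_finrank (K := F) (V := K)
    rw [hK, hF] at h
    exact (Nat.pow_right_injective le_rfl (show 2 ^ 4 = 2 ^ _ from h)).symm
  have : Fact (Nat.Prime 2) := ⟨Nat.prime_two⟩
  have : CharP F 2 := charP_of_card_eq_prime (by simpa using hF)
  have : CharP K 2 := charP_of_injective_algebraMap (algebraMap F K).injective 2
  have h2 : (2 : K) = 0 := CharTwo.two_eq_zero
  have h2F : (2 : F) = 0 := CharTwo.two_eq_zero
  have h16 : ∀ z : K, z ^ 16 = z := fun z => by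
    have := FiniteField.pow_card z
    rwa [hK] at this
  have hF01 : ∀ c : F, c = 0 ∨ c = 1 := fun c => by
    have := FiniteField.pow_card c
    rw [hF] at this
    have h : c * (c - 1) = 0 := by linear_combination this
    rcases mul_eq_zero.1 h with h | h
    · exact Or.inl h
    · exact Or.inr (sub_eq_zero.1 h)
  set T := Algebra.trace F K with hT
  have inj := (algebraMap F K).injective
  have hTr : ∀ z : K, algebraMap F K (T z) = z + z ^ 2 + z ^ 4 + z ^ 8 := fun z => by
    have := FiniteField.algebraMap_trace_eq_sum_pow F K z
    rw [hfr, Nat.card_eq_fintype_card, hF] at this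
    rw [hT, this]
    simp [Finset.sum_range_succ]
  -- generator
  obtain ⟨g, hg⟩ := IsCyclic.exists_ofOrder_eq_natCard (α := Kˣ)
  have hg15 : orderOf g = 15 := by
    rw [hg, Nat.card_units, Nat.card_eq_fintype_card, hK]
  have g5 : (g : K) ^ 5 ≠ 1 := fun h => by
    have : g ^ 5 = 1 := Units.ext (by simpa using h)
    have := orderOf_dvd_of_pow_eq_one this
    rw [hg15] at this
    omega
  have g3 : (g : K) ^ 3 ≠ 1 := fun h => by
    have : g ^ 3 = 1 := Units.ext (by simpa using h)
    have := orderOf_dvd_of_pow_eq_one this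
    rw [hg15] at this
    omega
  have g0 : (g : K) ≠ 0 := g.ne_zero
  have gg15 : (g : K) ^ 15 = 1 := mul_left_cancel₀ g0 (by linear_combination h16 (g : K))
  obtain ⟨w, hw⟩ : ∃ w : K, w ^ 2 + w + 1 = 0 := by
    refine ⟨(g : K) ^ 5, ?_⟩
    have : ((g : K) ^ 5 - 1) * (((g : K) ^ 5) ^ 2 + (g : K) ^ 5 + 1) = 0 := by
      linear_combination gg15
    exact (mul_eq_zero.1 this).resolve_left (sub_ne_zero.2 g5)
  obtain ⟨n, hn⟩ : ∃ n : K, n ^ 4 = n + 1 := by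
    have hs : (g : K) + (g : K) ^ 4 ≠ 0 := fun h => g3 (by
      apply mul_left_cancel₀ g0
      linear_combination h - (g : K) * h2)
    have hs4 : ((g : K) + (g : K) ^ 4) ^ 4 = (g : K) + (g : K) ^ 4 := by
      have : ((g : K) + (g : K) ^ 4) ^ 4 = (g : K) ^ 4 + (g : K) ^ 16 := by
        linear_combination (2 * (g : K) ^ 7 + 3 * (g : K) ^ 10 + 2 * (g : K) ^ 13) * h2
      rw [this, h16, add_comm]
    refine ⟨(g : K) / ((g : K) + (g : K) ^ 4), ?_⟩
    rw [div_pow, hs4]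
    rw [div_add_one hs]
    congr 1
    linear_combination -(g : K) * h2
  have hw2 : w ^ 2 = w + 1 := by linear_combination hw - (w + 1) * h2
  have hn8 : n ^ 8 = n ^ 2 + 1 := by
    linear_combination (n ^ 4 + n + 1) * hn + n * h2
  have hw4 : w ^ 4 = w := by linear_combination (w ^ 2 - w) * hw
  have hw8 : w ^ 8 = w + 1 := by
    linear_combination (w ^ 4 + w) * hw4 + hw2
  have hw1 : w ^ 3 = 1 := by linear_combination (w - 1) * hw
  have hw1' : (w + 1) ^ 3 = 1 := by linear_combination (w + 2) * hw - h2
  have t2 : T n = 0 := inj (by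
    rw [hTr, hn8, hn, map_zero]; linear_combination (n + n ^ 2 + 1) * h2)
  have t2w : T (n * w) = 1 := inj (by
    rw [hTr, map_one]; simp only [mul_pow]
    rw [hn8, hn, hw8, hw4, hw2]
    linear_combination (n * w + n ^ 2 * w + n ^ 2 + w) * h2)
  have t1 : T (n * (w + 1)) = 1 := by
    rw [mul_add, map_add, t2w, mul_one, t2, add_zero]
  have t1w : T (n * (w + 1) * w) = 0 := by
    have : n * (w + 1) * w = n := by
      linear_combination n * hw - n * h2
    rw [this, t2]
  -- the x-coordinates
  have hx : ∀ i, (e i : K × K).1 = 0 ∨ (e i : K × K).1 = 1 ∨ (e i : K × K).1 = w ∨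
      (e i : K × K).1 = w + 1 := by
    intro i
    have h : (e i : K × K).1 ^ 3 = _ := (e i).2
    generalize (e i : K × K).1 = x at h ⊢
    generalize (e i : K × K).2 = y at h
    have h' : x ^ 3 = algebraMap F K (T y) := by
      rw [hTr, h]; simp [Finset.sum_range_succ]
    rcases hF01 (T y) with h0 | h0
    · rw [h0, map_zero] at h'
      left; exact pow_eq_zero_iff (by norm_num) |>.1 h'
    · right
      rw [h0, map_one] at h'
      have : (x - 1) * ((x - w) * (x - (w + 1))) = 0 := by
        linear_combination h' + (x - 1) * hw - (x ^ 2 * w + x ^ 2 - x * w - x - 1 + x) * h2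
      rcases mul_eq_zero.1 this with h | h
      · left; exact sub_eq_zero.1 h
      · right
        rcases mul_eq_zero.1 h with h | h
        · left; exact sub_eq_zero.1 h
        · right; exact sub_eq_zero.1 h
  have hpt : ∀ x y : K, x ^ 3 = algebraMap F K (T y) → ∃ i, (e i : K × K) = (x, y) := by
    intro x y h
    have hm : (x, y) ∈ ntCurve K 2 4 3 := by
      change x ^ 3 = _
      rw [h, hTr]; simp [Finset.sum_range_succ]
    exact ⟨e.symm ⟨_, hm⟩, by simp⟩
  have hxT : ∀ i (d : K), T (d * (e i : K × K).1) =
      T d * T (n * (w + 1) * (e i : K × K).1) + T (d * w) * T (n * (e i : K × K).1) := by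
    intro i d
    rcases hx i with h | h | h | h <;> rw [h]
    · simp
    · simp [t1, t2]
    · rw [t1w, t2w]; ring
    · rw [mul_add (n * (w + 1)), map_add, t1w, mul_one, t1, mul_add d, map_add, mul_one]
      simp; ring
  have hsq : ∀ c y : K, T (c * y ^ 2) = T (c ^ 8 * y) := by
    intro c y
    apply inj
    rw [hTr, hTr]
    have hc := h16 c
    have hy := h16 y
    have e1 : (c * y ^ 2) ^ 8 = c ^ 8 * y := by
      linear_combination c ^ 8 * hy
    have e2 : (c ^ 8 * y) ^ 2 = c * y ^ 2 := by
      linear_combination y ^ 2 * hc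
    have e3 : (c ^ 8 * y) ^ 4 = (c * y ^ 2) ^ 2 := by rw [← e2]; ring
    have e4 : (c ^ 8 * y) ^ 8 = (c * y ^ 2) ^ 4 := by rw [← e2]; ring
    rw [e1, e2, e3, e4]; ring
  have hsurj : ∀ c : F, ∃ z, T z = c := Algebra.trace_surjective F K
  let Φ : (F × K × F × F) →ₗ[F] (Fin 32 → F) :=
    { toFun := fun p i => p.1 + T (p.2.1 * (e i : K × K).2) +
        p.2.2.1 * T (n * (w + 1) * (e i : K × K).1) + p.2.2.2 * T (n * (e i : K × K).1)
      map_add' := fun p q => by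
        funext i
        simp only [Prod.fst_add, Prod.snd_add, add_mul, map_add, Pi.add_apply]
        ring
      map_smul' := fun c p => by
        funext i
        simp only [Prod.smul_fst, Prod.smul_snd, smul_mul_assoc, map_smul, Pi.smul_apply,
          smul_eq_mul, RingHom.id_apply]
        ring }
  have hΦ : ∀ p i, Φ p i = p.1 + T (p.2.1 * (e i : K × K).2) +
        p.2.2.1 * T (n * (w + 1) * (e i : K × K).1) + p.2.2.2 * T (n * (e i : K × K).1) :=
    fun _ _ => rfl
  have hinj : Function.Injective Φ := by
    rw [← LinearMap.ker_eq_bot, LinearMap.ker_eq_bot']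
    rintro ⟨c, β, a, b⟩ hp
    have key : ∀ x y : K, x ^ 3 = algebraMap F K (T y) →
        c + T (β * y) + a * T (n * (w + 1) * x) + b * T (n * x) = 0 := by
      intro x y h
      obtain ⟨i, hi⟩ := hpt x y h
      have := congrFun hp i
      rw [hΦ, hi] at this
      exact this
    have hc : c = 0 := by simpa using key 0 0 (by simp)
    subst hc
    obtain ⟨y, hy⟩ := hsurj 1
    have k1 := key 1 y (by simp [hy])
    have k2 := key w y (by simp [hy, hw1])
    have k3 := key (w + 1) y (by simp [hy, hw1'])
    rw [mul_one, mul_one, t1, t2] at k1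
    rw [t1w, t2w] at k2
    rw [mul_add (n * (w + 1)), map_add, t1w, mul_one, t1] at k3
    have hb0 : T (β * y) = 0 := by
      linear_combination k1 + k2 + k3 - (T (β * y) + a + b) * h2F
    rw [hb0] at k1 k2
    have ha : a = 0 := by simpa using k1
    have hb : b = 0 := by simpa using k2
    subst ha hb
    have hβ : β = 0 := by
      apply (traceForm_nondegenerate F K).1
      intro z
      rw [Algebra.traceForm_apply]
      rcases hF01 (T z) with h | h
      · simpa using key 0 z (by simp [h])
      · simpa using key 1 z (by simp [h])
    subst hβ
    rfl
  have hrange : traceCode F (ntCode K 2 4 3 (fun i => ((e i : K × K))) 8) =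
      LinearMap.range Φ := by
    apply le_antisymm
    · rintro _ ⟨v, hv0, rfl⟩
      have hv' : ∃ α β γ δ : K, ∀ i, v i = α + β * (e i : K × K).2 +
          γ * (e i : K × K).2 ^ 2 + δ * (e i : K × K).1 := by
        have hv : v ∈ ntCode K 2 4 3 (fun i => ((e i : K × K))) 8 := hv0
        clear hv0
        unfold ntCode at hv
        induction hv using Submodule.span_induction with
        | mem v h =>
          obtain ⟨a, b, hab, rfl⟩ := h
          norm_num at hab
          have : (a = 0 ∧ b = 0) ∨ (a = 0 ∧ b = 1) ∨ (a = 0 ∧ b = 2) ∨ (a = 1 ∧ b = 0) := by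
            omega
          rcases this with ⟨rfl, rfl⟩ | ⟨rfl, rfl⟩ | ⟨rfl, rfl⟩ | ⟨rfl, rfl⟩
          · exact ⟨1, 0, 0, 0, fun i => by simp⟩
          · exact ⟨0, 1, 0, 0, fun i => by simp⟩
          · exact ⟨0, 0, 1, 0, fun i => by simp⟩
          · exact ⟨0, 0, 0, 1, fun i => by simp⟩
        | zero => exact ⟨0, 0, 0, 0, fun i => by simp⟩
        | add u v _ _ hu hv =>
          obtain ⟨a, b, c, d, h⟩ := hu
          obtain ⟨a', b', c', d', h'⟩ := hv
          exact ⟨a + a', b + b', c + c', d + d', fun i => by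
            rw [Pi.add_apply, h, h']; ring⟩
        | smul k v _ hv =>
          obtain ⟨a, b, c, d, h⟩ := hv
          exact ⟨k * a, k * b, k * c, k * d, fun i => by
            rw [Pi.smul_apply, h, smul_eq_mul]; ring⟩
      obtain ⟨α, β, γ, δ, h⟩ := hv'
      refine ⟨(T α, β + γ ^ 8, T δ, T (δ * w)), ?_⟩
      funext i
      rw [hΦ]
      change _ = T (v i)
      rw [h i, map_add, map_add, map_add, hsq, hxT i δ, add_mul, map_add]
      ring
    · rintro _ ⟨⟨c, β, a, b⟩, rfl⟩
      obtain ⟨α, hα⟩ := hsurj c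
      have hm : ∀ s t : ℕ, 8 * s + 3 * t ≤ 8 →
          (fun i => (e i : K × K).1 ^ s * (e i : K × K).2 ^ t) ∈
            ntCode K 2 4 3 (fun i => ((e i : K × K))) 8 := by
        intro s t hst
        exact Submodule.subset_span ⟨s, t, by norm_num; omega, rfl⟩
      refine ⟨_, Submodule.add_mem _ (Submodule.add_mem _
        (Submodule.smul_mem _ α (hm 0 0 (by norm_num)))
        (Submodule.smul_mem _ β (hm 0 1 (by norm_num))))
        (Submodule.smul_mem _ (a • (n * (w + 1)) + b • n) (hm 1 0 (by norm_num))), ?_⟩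
      funext i
      rw [hΦ]
      change T _ = _
      simp [add_mul, hα]
      ring
  rw [hrange, LinearMap.finrank_range_of_inj hinj]
  simp [hfr]
end

section
/- For q = 2, r = 4, u = 3, the binary subfield subcode NT_3(36)|F_2 of the extended Norm–Trace code over F_16 is a [32, 25, 4] binary linear code: it has length 32, F_2-dimension 25, and minimum Hamming distance 4. -/
open scoped BigOperators

namespace NTAux

/-- The trace polynomial. -/
def tr {K : Type*} [Field K] (y : K) : K := y + y ^ 2 + y ^ 4 + y ^ 8

theorem two_eq_zero {K : Type*} [Field K] [Fintype K] (hK : Fintype.card K = 16) :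
    (2 : K) = 0 := by
  have h := FiniteField.cast_card_eq_zero K
  rw [hK] at h
  have h' : (2 : K) ^ 4 = 0 := by
    rw [← h]; norm_num
  exact pow_eq_zero_iff (by norm_num) |>.1 h'

theorem tr_zero_or_one {K : Type*} [Field K] [Fintype K] (hK : Fintype.card K = 16) (y : K) :
    tr y = 0 ∨ tr y = 1 := by
  have h2 := two_eq_zero hK
  have h16 : y ^ 16 = y := by rw [← hK]; exact FiniteField.pow_card y
  have : tr y * (tr y - 1) = 0 := by
    unfold tr
    linear_combination h16 + (y^3 + y^5 + y^9 + y^6 + y^10 + y^12) * h2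
  rcases mul_eq_zero.1 this with h | h
  · exact Or.inl h
  · exact Or.inr (sub_eq_zero.1 h)

theorem tr_add {K : Type*} [Field K] (h2 : (2 : K) = 0) (y z : K) :
    tr (y + z) = tr y + tr z := by
  have : CharP K 2 := CharTwo.of_one_ne_zero_of_two_eq_zero one_ne_zero h2
  have e2 : (y + z) ^ 2 = y ^ 2 + z ^ 2 := add_pow_char y z 2
  have e4 : (y + z) ^ 4 = y ^ 4 + z ^ 4 := add_pow_char_pow (p := 2) (n := 2) y z
  have e8 : (y + z) ^ 8 = y ^ 8 + z ^ 8 := add_pow_char_pow (p := 2) (n := 3) y z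
  unfold tr
  rw [e2, e4, e8]; ring

theorem exists_omega {K : Type*} [Field K] [Fintype K] (hK : Fintype.card K = 16) :
    ∃ w : K, w ^ 2 + w + 1 = 0 := by
  classical
  have hc : Fintype.card Kˣ = 15 := by rw [Fintype.card_units, hK]
  have : Fact (Nat.Prime 3) := ⟨by norm_num⟩
  obtain ⟨g, hg⟩ := exists_prime_orderOf_dvd_card (G := Kˣ) 3 (by rw [hc]; norm_num)
  have h3 : (g : K) ^ 3 = 1 := by
    have := pow_orderOf_eq_one g
    rw [hg] at this
    have h := congrArg Units.val this
    simpa using h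
  have h1 : (g : K) ≠ 1 := by
    intro h
    have : g = 1 := Units.ext h
    rw [this, orderOf_one] at hg
    norm_num at hg
  refine ⟨g, ?_⟩
  have : ((g : K) - 1) * ((g : K) ^ 2 + g + 1) = 0 := by linear_combination h3
  exact (mul_eq_zero.1 this).resolve_left (sub_ne_zero.2 h1)

theorem coeffs_zero {K : Type*} [Field K] {n : ℕ} (k : Fin n → K) (s : Finset K)
    (hs : n ≤ s.card) (h : ∀ x ∈ s, ∑ j, k j * x ^ (j : ℕ) = 0) : k = 0 := by
  classical
  rcases Nat.eq_zero_or_pos n with rfl | hn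
  · exact Subsingleton.elim _ _
  let p : Polynomial K := ∑ j : Fin n, Polynomial.C (k j) * Polynomial.X ^ (j : ℕ)
  have hp : p = 0 := by
    refine Polynomial.eq_zero_of_natDegree_lt_card_of_eval_eq_zero' p s ?_ ?_
    · intro x hx
      simpa [p, Polynomial.eval_finsetSum] using h x hx
    · refine lt_of_lt_of_le ?_ hs
      have : p.natDegree ≤ n - 1 := by
        refine Polynomial.natDegree_sum_le_of_forall_le _ _ ?_
        intro j _
        refine (Polynomial.natDegree_C_mul_X_pow_le _ _).trans ?_
        have := j.2
        omega
      omega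
  funext j
  have := congrArg (fun q => Polynomial.coeff q (j : ℕ)) hp
  simpa [p, Polynomial.finsetSum_coeff, Polynomial.coeff_C_mul, Polynomial.coeff_X_pow,
    Fin.val_inj] using this

theorem sum_pow_lt {K : Type*} [Field K] [Fintype K] (hK : Fintype.card K = 16) (b : ℕ)
    (hb : b < 15) : ∑ y : K, y ^ b = 0 :=
  FiniteField.sum_pow_lt_card_sub_one K b (by rw [hK]; exact hb)

theorem sum_pow_15 {K : Type*} [Field K] [Fintype K] (hK : Fintype.card K = 16) :
    ∑ y : K, y ^ 15 = 1 := by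
  classical
  have h2 := two_eq_zero hK
  have h : ∀ y : K, y ^ 15 = 1 - (if y = 0 then 1 else 0) := by
    intro y
    split_ifs with hy
    · simp [hy]
    · have := FiniteField.pow_card_sub_one_eq_one y hy
      rw [hK] at this
      simpa using this
  have h16 : (16 : K) = 0 := by linear_combination 8 * h2
  simp only [h, Finset.sum_sub_distrib]
  simp [hK, h16]
  linear_combination -h2

/-- Power sums weighted by the trace. -/
theorem sum_tr_pow {K : Type*} [Field K] [Fintype K] (hK : Fintype.card K = 16) (b : ℕ)
    (hb : b < 7) : ∑ y : K, tr y * y ^ b = 0 := by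
  have : ∀ y : K, tr y * y ^ b = y ^ (b+1) + y ^ (b+2) + y ^ (b+4) + y ^ (b+8) := by
    intro y; unfold tr; ring
  simp only [this, Finset.sum_add_distrib]
  rw [sum_pow_lt hK _ (by omega), sum_pow_lt hK _ (by omega), sum_pow_lt hK _ (by omega),
    sum_pow_lt hK _ (by omega)]
  simp

theorem sum_tr_pow_seven {K : Type*} [Field K] [Fintype K] (hK : Fintype.card K = 16) :
    ∑ y : K, tr y * y ^ 7 = 1 := by
  have : ∀ y : K, tr y * y ^ 7 = y ^ 8 + y ^ 9 + y ^ 11 + y ^ 15 := by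
    intro y; unfold tr; ring
  simp only [this, Finset.sum_add_distrib]
  rw [sum_pow_lt hK _ (by omega), sum_pow_lt hK _ (by omega), sum_pow_lt hK _ (by omega),
    sum_pow_15 hK]
  simp

theorem exists_tr_one {K : Type*} [Field K] [Fintype K] (hK : Fintype.card K = 16) :
    ∃ y : K, tr y = 1 := by
  by_contra hne
  push Not at hne
  have h := sum_tr_pow_seven hK
  have h0 : ∀ y : K, tr y = 0 := fun y => (tr_zero_or_one hK y).resolve_right (hne y)
  simp [h0] at h

theorem card_tr {K : Type*} [Field K] [Fintype K] [DecidableEq K] (hK : Fintype.card K = 16)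
    (t : K) (ht : t = 0 ∨ t = 1) : (Finset.univ.filter fun y : K => tr y = t).card = 8 := by
  have h2 := two_eq_zero hK
  obtain ⟨y1, hy1⟩ := exists_tr_one hK
  have e1 : (Finset.univ.filter fun y : K => tr y = 0).card
      = (Finset.univ.filter fun y : K => tr y = 1).card := by
    refine Finset.card_bij (fun y _ => y + y1) ?_ ?_ ?_
    · intro y hy
      simp only [Finset.mem_filter, Finset.mem_univ, true_and] at hy ⊢
      rw [tr_add h2, hy, hy1, zero_add]
    · intro a _ b _ h
      exact add_right_cancel h
    · intro z hz
      simp only [Finset.mem_filter, Finset.mem_univ, true_and] at hz ⊢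
      refine ⟨z + y1, ?_, by linear_combination y1 * h2⟩
      rw [tr_add h2, hz, hy1]
      linear_combination h2
  have e2 := Finset.card_filter_add_card_filter_not (s := (Finset.univ : Finset K))
    (fun y : K => tr y = 0)
  have e3 : (Finset.univ.filter fun y : K => ¬ tr y = 0)
      = (Finset.univ.filter fun y : K => tr y = 1) := by
    ext y
    simp only [Finset.mem_filter, Finset.mem_univ, true_and]
    constructor
    · intro h; exact (tr_zero_or_one hK y).resolve_left h
    · intro h; rw [h]; exact one_ne_zero
  rw [e3, Finset.card_univ, hK] at e2
  rcases ht with rfl | rfl <;> omega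

theorem mem_curve {K : Type*} [Field K] (p : K × K) :
    p ∈ ntCurve K 2 4 3 ↔ p.1 ^ 3 = tr p.2 := by
  simp [ntCurve, tr, Finset.sum_range_succ]

theorem cube_eq_one {K : Type*} [Field K] {w : K} (hw : w ^ 2 + w + 1 = 0) (x : K) :
    x ^ 3 = 1 ↔ x = 1 ∨ x = w ∨ x = w ^ 2 := by
  have key : x ^ 3 - 1 = (x - 1) * ((x - w) * (x - w ^ 2)) := by
    linear_combination (x - 1) * (x + 1 - w) * hw
  rw [← sub_eq_zero, key, mul_eq_zero, mul_eq_zero, sub_eq_zero, sub_eq_zero, sub_eq_zero]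

theorem omega_ne {K : Type*} [Field K] (h2 : (2 : K) = 0) {w : K} (hw : w ^ 2 + w + 1 = 0) :
    w ≠ 0 ∧ w ≠ 1 ∧ w ≠ w ^ 2 ∧ w ^ 2 ≠ 1 ∧ w ^ 2 ≠ 0 := by
  have h0 : w ≠ 0 := by rintro rfl; simp at hw
  have h1 : w ≠ 1 := by
    rintro rfl
    apply one_ne_zero (α := K)
    linear_combination hw - h2
  refine ⟨h0, h1, ?_, ?_, pow_ne_zero _ h0⟩
  · intro h
    apply h1
    have : w * (w - 1) = 0 := by linear_combination -h
    exact sub_eq_zero.1 ((mul_eq_zero.1 this).resolve_left h0)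
  · intro h
    apply h0
    linear_combination hw - h - h2

/-- Sum over the curve of a monomial. -/
theorem curve_sum {K : Type*} [Field K] [Fintype K] (hK : Fintype.card K = 16)
    {w : K} (hw : w ^ 2 + w + 1 = 0)
    (e : Fin 32 ≃ ↥(ntCurve K 2 4 3)) (a b : ℕ) :
    ∑ i, (e i : K × K).1 ^ a * (e i : K × K).2 ^ b
      = 0 ^ a * (∑ y : K, y ^ b) +
        (1 + w ^ a + (w ^ 2) ^ a - 0 ^ a) * ∑ y : K, tr y * y ^ b := by
  classical
  have h2 := two_eq_zero hK
  obtain ⟨hw0, hw1, hw2, hw3, hw4⟩ := omega_ne h2 hw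
  rw [Equiv.sum_comp e (fun p : ↥(ntCurve K 2 4 3) => (p : K × K).1 ^ a * (p : K × K).2 ^ b)]
  have : ∑ p : ↥(ntCurve K 2 4 3), (p : K × K).1 ^ a * (p : K × K).2 ^ b
      = ∑ p ∈ Finset.univ.filter (fun p : K × K => p ∈ ntCurve K 2 4 3), p.1 ^ a * p.2 ^ b := by
    symm
    apply Finset.sum_subtype
    simp
  rw [this, Finset.sum_filter, Fintype.sum_prod_type_right, Finset.mul_sum, Finset.mul_sum,
    ← Finset.sum_add_distrib]
  refine Finset.sum_congr rfl fun y _ => ?_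
  simp only [mem_curve]
  rw [← Finset.sum_filter]
  rcases tr_zero_or_one hK y with h | h
  · have : (Finset.univ.filter fun x : K => x ^ 3 = tr y) = {0} := by
      ext x; simp [h]
    rw [this]; simp [h]
  · have : (Finset.univ.filter fun x : K => x ^ 3 = tr y) = {1, w, w ^ 2} := by
      ext x; simp [h, cube_eq_one hw]
    rw [this, Finset.sum_insert, Finset.sum_pair hw2, h]
    · ring
    · simp [hw1.symm, hw3.symm]

/-- The vanishing monomials. -/
theorem curve_sum_zero {K : Type*} [Field K] [Fintype K] (hK : Fintype.card K = 16)
    (e : Fin 32 ≃ ↥(ntCurve K 2 4 3)) (a b : ℕ) (hab : a ≤ 5)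
    (hb : b < 15) (h : a = 3 → b < 7) :
    ∑ i, (e i : K × K).1 ^ a * (e i : K × K).2 ^ b = 0 := by
  have h2 := two_eq_zero hK
  obtain ⟨w, hw⟩ := exists_omega hK
  rw [curve_sum hK hw e, sum_pow_lt hK b hb, mul_zero, zero_add]
  have h3 : w ^ 3 = 1 := by linear_combination (w - 1) * hw
  by_cases ha : a = 3
  · rw [sum_tr_pow hK b (h ha), mul_zero]
  · have : (1 + w ^ a + (w ^ 2) ^ a - 0 ^ a) = 0 := by
      interval_cases a
      · simp; linear_combination h2
      · simp; linear_combination hw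
      · simp; linear_combination hw + w * h3
      · exact absurd rfl ha
      · simp; linear_combination hw + (w + w^5 + w^2) * h3
      · simp; linear_combination hw + (w^2 + w^7 + w^4 + w) * h3
    rw [this, zero_mul]

theorem curve_sum_top {K : Type*} [Field K] [Fintype K] (hK : Fintype.card K = 16)
    (e : Fin 32 ≃ ↥(ntCurve K 2 4 3)) :
    ∑ i, (e i : K × K).1 ^ 3 * (e i : K × K).2 ^ 7 = 1 := by
  have h2 := two_eq_zero hK
  obtain ⟨w, hw⟩ := exists_omega hK
  rw [curve_sum hK hw e, sum_tr_pow_seven hK]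
  have h3 : w ^ 3 = 1 := by linear_combination (w - 1) * hw
  have h6 : (w ^ 2) ^ 3 = 1 := by linear_combination (w^3 + 1) * h3
  rw [h3, h6]
  simp
  linear_combination h2

/-- Evaluation of the reduced monomials at the curve. -/
noncomputable def evalMap {K : Type*} [Field K] (P : Fin 32 → K × K) :
    (Fin 4 × Fin 8 → K) →ₗ[K] (Fin 32 → K) where
  toFun k := fun i => ∑ m, k m * ((P i).1 ^ (m.1 : ℕ) * (P i).2 ^ (m.2 : ℕ))
  map_add' k l := by
    funext i
    simp [add_mul, Finset.sum_add_distrib]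
  map_smul' t k := by
    funext i
    simp [Finset.mul_sum, mul_assoc]

theorem evalMap_surjective {K : Type*} [Field K] [Fintype K] (hK : Fintype.card K = 16)
    (e : Fin 32 ≃ ↥(ntCurve K 2 4 3)) :
    Function.Surjective (evalMap (fun i => (e i : K × K))) := by
  classical
  rw [← LinearMap.injective_iff_surjective_of_finrank_eq_finrank (by simp)]
  rw [injective_iff_map_eq_zero]
  intro k hk
  have h2 := two_eq_zero hK
  obtain ⟨w, hw⟩ := exists_omega hK
  obtain ⟨hw0, hw1, hw2, hw3, hw4⟩ := omega_ne h2 hw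
  have hpt : ∀ x y : K, x ^ 3 = tr y →
      ∑ m : Fin 4 × Fin 8, k m * (x ^ (m.1 : ℕ) * y ^ (m.2 : ℕ)) = 0 := by
    intro x y hxy
    have := congrFun hk (e.symm ⟨(x, y), (mem_curve _).2 hxy⟩)
    simpa [evalMap] using this
  have hx : ∀ x ∈ ({0, 1, w, w ^ 2} : Finset K),
      (fun b : Fin 8 => ∑ a : Fin 4, k (a, b) * x ^ (a : ℕ)) = 0 := by
    intro x hx
    have hx3 : x ^ 3 = 0 ∨ x ^ 3 = 1 := by
      rw [cube_eq_one hw]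
      simp only [Finset.mem_insert, Finset.mem_singleton] at hx
      rcases hx with rfl | hx
      · left; simp
      · right; exact hx
    refine coeffs_zero _ (Finset.univ.filter fun y : K => tr y = x ^ 3)
      (by rw [card_tr hK _ hx3]) ?_
    intro y hy
    simp only [Finset.mem_filter, Finset.mem_univ, true_and] at hy
    have := hpt x y hy.symm
    rw [Fintype.sum_prod_type_right] at this
    rw [← this]
    refine Finset.sum_congr rfl fun b _ => ?_
    rw [Finset.sum_mul]
    refine Finset.sum_congr rfl fun a _ => ?_
    ring
  funext m
  obtain ⟨a, b⟩ := m
  have := coeffs_zero (fun a => k (a, b)) ({0, 1, w, w ^ 2} : Finset K) ?_ ?_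
  · exact congrFun this a
  · rw [Finset.card_insert_of_notMem, Finset.card_insert_of_notMem, Finset.card_pair hw2]
    · simp [hw1.symm, hw3.symm]
    · simp [hw0.symm, hw4.symm]
  · intro x hx'
    exact congrFun (hx x hx') b

theorem pairing {K : Type*} [Field K] (P : Fin 32 → K × K) (k : Fin 4 × Fin 8 → K) (a b : ℕ) :
    ∑ i, evalMap P k i * ((P i).1 ^ a * (P i).2 ^ b)
      = ∑ m, k m * ∑ i, (P i).1 ^ ((m.1 : ℕ) + a) * (P i).2 ^ ((m.2 : ℕ) + b) := by
  simp only [evalMap, LinearMap.coe_mk, AddHom.coe_mk, Finset.sum_mul, Finset.mul_sum]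
  rw [Finset.sum_comm]
  refine Finset.sum_congr rfl fun m _ => Finset.sum_congr rfl fun i _ => ?_
  ring

/-- One elimination step. -/
theorem elim_step {K : Type*} [Field K] [Fintype K] (hK : Fintype.card K = 16)
    (e : Fin 32 ≃ ↥(ntCurve K 2 4 3)) (k : Fin 4 × Fin 8 → K) (a b : ℕ) (m0 : Fin 4 × Fin 8)
    (ha : (m0.1 : ℕ) + a = 3) (hb : (m0.2 : ℕ) + b = 7) (ha1 : a ≤ 2)
    (hk : ∀ m : Fin 4 × Fin 8, (m.1 : ℕ) + a = 3 → 7 < (m.2 : ℕ) + b → k m = 0)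
    (h : ∑ i, evalMap (fun i => (e i : K × K)) k i *
      ((e i : K × K).1 ^ a * (e i : K × K).2 ^ b) = 0) : k m0 = 0 := by
  have hp := pairing (fun i => (e i : K × K)) k a b
  rw [h, Finset.sum_eq_single m0] at hp
  · rw [ha, hb, curve_sum_top hK e, mul_one] at hp
    exact hp.symm
  · intro m _ hm
    by_cases h1 : (m.1 : ℕ) + a = 3
    · by_cases h7 : 7 < (m.2 : ℕ) + b
      · rw [hk m h1 h7, zero_mul]
      · rw [curve_sum_zero hK e, mul_zero]
        · omega
        · omega
        · intro _
          have : (m.2 : ℕ) + b ≠ 7 := by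
            intro h8
            apply hm
            apply Prod.ext <;> apply Fin.ext <;> omega
          omega
    · rw [curve_sum_zero hK e, mul_zero]
      · have := m.1.2
        omega
      · have := m.2.2
        have := m0.2.2
        omega
      · intro h3; exact absurd h3 h1
  · simp

theorem mem_code {K : Type*} [Field K] [Fintype K] (hK : Fintype.card K = 16)
    (e : Fin 32 ≃ ↥(ntCurve K 2 4 3)) (v : Fin 32 → K)
    (h0 : ∑ i, v i = 0) (hx : ∑ i, v i * (e i : K × K).1 = 0)
    (hy : ∑ i, v i * (e i : K × K).2 = 0) (hyy : ∑ i, v i * (e i : K × K).2 ^ 2 = 0) :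
    v ∈ ntCode K 2 4 3 (fun i => (e i : K × K)) 36 := by
  obtain ⟨k, rfl⟩ := evalMap_surjective hK e v
  have k37 : k (3, 7) = 0 := by
    refine elim_step hK e k 0 0 (3, 7) rfl rfl (by norm_num) ?_ (by simpa using h0)
    intro m _ h; omega
  have k36 : k (3, 6) = 0 := by
    refine elim_step hK e k 0 1 (3, 6) rfl rfl (by norm_num) ?_ (by simpa using hy)
    intro m h1 h
    have : m = (3, 7) := by
      apply Prod.ext <;> apply Fin.ext <;> simp <;> omega
    rw [this, k37]
  have k35 : k (3, 5) = 0 := by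
    refine elim_step hK e k 0 2 (3, 5) rfl rfl (by norm_num) ?_ (by simpa using hyy)
    intro m h1 h
    have : m = (3, 7) ∨ m = (3, 6) := by
      by_cases h7 : (m.2 : ℕ) = 7
      · left; apply Prod.ext <;> apply Fin.ext <;> simp <;> omega
      · right; apply Prod.ext <;> apply Fin.ext <;> simp <;> omega
    rcases this with h | h
    · rw [h, k37]
    · rw [h, k36]
  have k27 : k (2, 7) = 0 := by
    refine elim_step hK e k 1 0 (2, 7) rfl rfl (by norm_num) ?_ (by simpa using hx)
    intro m _ h; omega
  have hsum : evalMap (fun i => (e i : K × K)) k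
      = ∑ m : Fin 4 × Fin 8, k m • fun i =>
        (e i : K × K).1 ^ (m.1 : ℕ) * (e i : K × K).2 ^ (m.2 : ℕ) := by
    funext i
    simp [evalMap]
  rw [hsum]
  refine Submodule.sum_mem _ fun m _ => ?_
  by_cases hm : 8 * (m.1 : ℕ) + 3 * (m.2 : ℕ) ≤ 36
  · refine Submodule.smul_mem _ _ (Submodule.subset_span ⟨m.1, m.2, ?_, rfl⟩)
    push_cast
    norm_num
    omega
  · have : k m = 0 := by
      obtain ⟨a, b⟩ := m
      fin_cases a <;> fin_cases b <;> simp at hm <;> assumption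
    rw [this, zero_smul]
    exact Submodule.zero_mem _

theorem code_check {K : Type*} [Field K] [Fintype K] (hK : Fintype.card K = 16)
    (e : Fin 32 ≃ ↥(ntCurve K 2 4 3)) (c d : ℕ) (hcd : 8 * c + 3 * d ≤ 8) (v : Fin 32 → K)
    (hv : v ∈ ntCode K 2 4 3 (fun i => (e i : K × K)) 36) :
    ∑ i, v i * ((e i : K × K).1 ^ c * (e i : K × K).2 ^ d) = 0 := by
  unfold ntCode at hv
  induction hv using Submodule.span_induction with
  | mem v hv =>
    obtain ⟨a, b, hab, rfl⟩ := hv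
    norm_num at hab
    have hab' : 8 * a + 3 * b ≤ 36 := by omega
    have := curve_sum_zero hK e (a + c) (b + d) (by omega) (by omega) (by omega)
    rw [← this]
    refine Finset.sum_congr rfl fun i _ => ?_
    ring
  | zero => simp
  | add v w _ _ hv hw => simp [add_mul, Finset.sum_add_distrib, hv, hw]
  | smul t v _ hv => simp [mul_assoc, ← Finset.mul_sum, hv]

theorem F_zero_or_one {F : Type*} [Field F] [Fintype F] (hF : Fintype.card F = 2) (a : F) :
    a = 0 ∨ a = 1 := by
  have h : a ^ 2 = a := by
    have := FiniteField.pow_card a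
    rwa [hF] at this
  have : a * (a - 1) = 0 := by linear_combination h
  rcases mul_eq_zero.1 this with h | h
  · exact Or.inl h
  · exact Or.inr (sub_eq_zero.1 h)

/-- The parity check map of the binary code. -/
noncomputable def checkMap {K F : Type*} [Field K] [Field F] [Algebra F K]
    (P : Fin 32 → K × K) : (Fin 32 → F) →ₗ[F] (F × K × K) :=
  Fintype.linearCombination F (fun i => ((1 : F), P i))

theorem checkMap_eq_zero {K F : Type*} [Field K] [Field F] [Algebra F K]
    (P : Fin 32 → K × K) (c : Fin 32 → F) :
    checkMap P c = 0 ↔ ∑ i, c i = 0 ∧ ∑ i, algebraMap F K (c i) * (P i).1 = 0 ∧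
      ∑ i, algebraMap F K (c i) * (P i).2 = 0 := by
  simp [checkMap, Fintype.linearCombination_apply, Prod.ext_iff, Prod.fst_sum, Prod.snd_sum,
    Algebra.smul_def]

theorem subcode_eq_ker {K F : Type*} [Field K] [Fintype K] [Field F] [Fintype F] [Algebra F K]
    (hK : Fintype.card K = 16) (hF : Fintype.card F = 2)
    (e : Fin 32 ≃ ↥(ntCurve K 2 4 3)) :
    subfieldSubcode F (ntCode K 2 4 3 (fun i => ((e i : K × K))) 36)
      = LinearMap.ker (checkMap (F := F) (fun i => (e i : K × K))) := by
  have h2 := two_eq_zero hK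
  have : CharP K 2 := CharTwo.of_one_ne_zero_of_two_eq_zero one_ne_zero h2
  ext c
  rw [LinearMap.mem_ker, checkMap_eq_zero]
  have hmem : c ∈ subfieldSubcode F (ntCode K 2 4 3 (fun i => ((e i : K × K))) 36) ↔
      (fun i => algebraMap F K (c i)) ∈ ntCode K 2 4 3 (fun i => ((e i : K × K))) 36 := Iff.rfl
  rw [hmem]
  have hsum : ∑ i, c i = 0 ↔ ∑ i, algebraMap F K (c i) = 0 := by
    rw [← map_sum, map_eq_zero]
  rw [hsum]
  constructor
  · intro h
    refine ⟨?_, ?_, ?_⟩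
    · simpa using code_check hK e 0 0 (by norm_num) _ h
    · simpa using code_check hK e 1 0 (by norm_num) _ h
    · simpa using code_check hK e 0 1 (by norm_num) _ h
  · rintro ⟨h0, hx, hy⟩
    refine mem_code hK e _ h0 hx hy ?_
    have h := congrArg (fun t => t ^ 2) hy
    simp only [CharTwo.sum_sq] at h
    rw [zero_pow (by norm_num)] at h
    rw [← h]
    refine Finset.sum_congr rfl fun i _ => ?_
    rcases F_zero_or_one hF (c i) with h | h <;> simp [h]

/-- Parametrisation of the space of syndromes. -/
noncomputable def synMap {K : Type*} (F : Type*) [Field K] [Field F] [Algebra F K] (w : K) :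
    (F × (F × F) × K) →ₗ[F] (F × K × K) where
  toFun t := (t.1, algebraMap F K t.2.1.1 + algebraMap F K t.2.1.2 * w, t.2.2)
  map_add' s t := by
    simp; ring
  map_smul' a t := by
    simp [Algebra.smul_def]; ring

theorem synMap_injective {K F : Type*} [Field K] [Field F] [Fintype F] [Algebra F K]
    (hF : Fintype.card F = 2) (h2 : (2 : K) = 0) {w : K} (hw : w ^ 2 + w + 1 = 0) :
    Function.Injective (synMap F w) := by
  obtain ⟨hw0, hw1, hw2, hw3, hw4⟩ := omega_ne h2 hw
  rw [injective_iff_map_eq_zero]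
  rintro ⟨a, ⟨b, c⟩, y⟩ h
  simp only [synMap, LinearMap.coe_mk, AddHom.coe_mk, Prod.mk_eq_zero] at h
  obtain ⟨ha, hbc, hy⟩ := h
  have : b = 0 ∧ c = 0 := by
    rcases F_zero_or_one hF b with rfl | rfl <;> rcases F_zero_or_one hF c with rfl | rfl
    · simp
    · simp at hbc; exact absurd hbc hw0
    · simp at hbc
    · simp at hbc
      exact absurd (by linear_combination hbc - h2) hw1
  simp [ha, hy, this]

theorem range_checkMap {K F : Type*} [Field K] [Fintype K] [Field F] [Fintype F] [Algebra F K]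
    (hK : Fintype.card K = 16) (hF : Fintype.card F = 2)
    (e : Fin 32 ≃ ↥(ntCurve K 2 4 3)) {w : K} (hw : w ^ 2 + w + 1 = 0) :
    LinearMap.range (checkMap (F := F) (fun i => (e i : K × K)))
      = LinearMap.range (synMap F w) := by
  have h2 := two_eq_zero hK
  have hw3 : w ^ 3 = 1 := by linear_combination (w - 1) * hw
  unfold checkMap
  rw [Fintype.range_linearCombination]
  set S := Submodule.span F (Set.range fun i => ((1 : F), (e i : K × K))) with hS
  have hpt : ∀ x y : K, x ^ 3 = tr y → ((1 : F), x, y) ∈ S := by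
    intro x y hxy
    refine Submodule.subset_span ⟨e.symm ⟨(x, y), (mem_curve _).2 hxy⟩, ?_⟩
    simp
  apply le_antisymm
  · rw [hS, Submodule.span_le]
    rintro _ ⟨i, rfl⟩
    have hi := (mem_curve _).1 (e i).2
    have hx : (e i : K × K).1 = 0 ∨ (e i : K × K).1 = 1 ∨ (e i : K × K).1 = w ∨
        (e i : K × K).1 = w ^ 2 := by
      rcases tr_zero_or_one hK (e i : K × K).2 with h | h
      · left; rw [h] at hi; simpa using hi
      · right; rw [h] at hi; exact (cube_eq_one hw _).1 hi
    have : ∃ b c : F, algebraMap F K b + algebraMap F K c * w = (e i : K × K).1 := by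
      rcases hx with h | h | h | h
      · exact ⟨0, 0, by simp [h]⟩
      · exact ⟨1, 0, by simp [h]⟩
      · exact ⟨0, 1, by simp [h]⟩
      · refine ⟨1, 1, ?_⟩
        rw [h, map_one]
        linear_combination (-1 : K) * hw + (1 + w) * h2
    obtain ⟨b, c, hbc⟩ := this
    exact ⟨(1, (b, c), (e i : K × K).2), by simp [synMap, hbc]⟩
  · obtain ⟨y1, hy1⟩ := exists_tr_one hK
    have t0 : tr (0 : K) = 0 := by simp [tr]
    have p0 : ((1 : F), (0 : K), (0 : K)) ∈ S := hpt 0 0 (by simp [t0])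
    have q0 : ∀ y : K, tr y = 0 → ((0 : F), (0 : K), y) ∈ S := by
      intro y hy
      have := S.sub_mem (hpt 0 y (by simp [hy])) p0
      simpa using this
    have r : ∀ x : K, x ^ 3 = 1 → ((0 : F), x, y1) ∈ S := by
      intro x hx
      have := S.sub_mem (hpt x y1 (by rw [hx, hy1])) p0
      simpa using this
    have q1 : ((0 : F), (0 : K), y1) ∈ S := by
      have h := S.add_mem (S.add_mem (r 1 (by simp)) (r w hw3))
        (r (w ^ 2) (by linear_combination (w ^ 3 + 1) * hw3))
      have e1 : ((0 : F), (1 : K), y1) + (0, w, y1) + (0, w ^ 2, y1) = (0, 0, y1) := by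
        ext
        · simp
        · simp; linear_combination hw
        · simp; linear_combination y1 * h2
      rwa [e1] at h
    have q : ∀ y : K, ((0 : F), (0 : K), y) ∈ S := by
      intro y
      rcases tr_zero_or_one hK y with h | h
      · exact q0 y h
      · have := S.add_mem (q0 (y + y1) (by rw [tr_add h2, h, hy1]; linear_combination h2)) q1
        have e1 : ((0 : F), (0 : K), y + y1) + (0, 0, y1) = (0, 0, y) := by
          ext
          · simp
          · simp
          · simp; linear_combination y1 * h2
        rwa [e1] at this
    have x1 : ∀ x : K, x ^ 3 = 1 → ((0 : F), x, (0 : K)) ∈ S := by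
      intro x hx
      have := S.sub_mem (r x hx) q1
      simpa using this
    rintro _ ⟨⟨a, ⟨b, c⟩, y⟩, rfl⟩
    have := S.add_mem (S.add_mem (S.smul_mem a p0) (S.smul_mem b (x1 1 (by simp))))
      (S.add_mem (S.smul_mem c (x1 w hw3)) (q y))
    simpa [synMap, Algebra.smul_def] using this

theorem finrank_code {K F : Type*} [Field K] [Fintype K] [Field F] [Fintype F] [Algebra F K]
    (hK : Fintype.card K = 16) (hF : Fintype.card F = 2)
    (e : Fin 32 ≃ ↥(ntCurve K 2 4 3)) :
    Module.finrank F (subfieldSubcode F (ntCode K 2 4 3 (fun i => ((e i : K × K))) 36)) = 25 := by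
  have h2 := two_eq_zero hK
  obtain ⟨w, hw⟩ := exists_omega hK
  have : Module.Finite F K := Module.Finite.of_finite
  have h4 : Module.finrank F K = 4 := by
    have h := Module.card_eq_pow_finrank (K := F) (V := K)
    rw [hK, hF] at h
    exact (Nat.pow_right_injective (le_refl 2) (h : 2 ^ 4 = _)).symm
  rw [subcode_eq_ker hK hF e]
  have h := LinearMap.finrank_range_add_finrank_ker (checkMap (F := F) (fun i => (e i : K × K)))
  rw [range_checkMap hK hF e hw,
    LinearMap.finrank_range_of_inj (synMap_injective hF h2 hw)] at h
  simp [h4] at h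
  omega

theorem minWt_code {K F : Type*} [Field K] [Fintype K] [Field F] [Fintype F] [Algebra F K]
    (hK : Fintype.card K = 16) (hF : Fintype.card F = 2)
    (e : Fin 32 ≃ ↥(ntCurve K 2 4 3)) :
    minWt ((subfieldSubcode F (ntCode K 2 4 3 (fun i => ((e i : K × K))) 36) :
        Set (Fin 32 → F))) = 4 := by
  classical
  have h2 := two_eq_zero hK
  obtain ⟨w, hw⟩ := exists_omega hK
  obtain ⟨hw0, hw1, hw2, hw3, hw4⟩ := omega_ne h2 hw
  have hw3' : w ^ 3 = 1 := by linear_combination (w - 1) * hw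
  -- membership for indicator vectors
  have hind : ∀ T : Finset (Fin 32), (fun i => if i ∈ T then (1 : F) else 0) ∈
      subfieldSubcode F (ntCode K 2 4 3 (fun i => ((e i : K × K))) 36) ↔
      (T.card : K) = 0 ∧ ∑ i ∈ T, (e i : K × K).1 = 0 ∧ ∑ i ∈ T, (e i : K × K).2 = 0 := by
    intro T
    rw [subcode_eq_ker hK hF e, LinearMap.mem_ker, checkMap_eq_zero]
    rw [← map_eq_zero (algebraMap F K)]
    simp [apply_ite (algebraMap F K)]
  have hwt : ∀ T : Finset (Fin 32), hammingWt (fun i => if i ∈ T then (1 : F) else 0) = T.card := by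
    intro T
    unfold hammingWt
    rw [← Set.ncard_coe_finset]
    congr 1
    ext i
    simp
  have hrep : ∀ c : Fin 32 → F, ∃ T : Finset (Fin 32), c = fun i => if i ∈ T then (1 : F) else 0 := by
    intro c
    refine ⟨Finset.univ.filter fun i => c i = 1, ?_⟩
    funext i
    rcases F_zero_or_one hF (c i) with h | h <;> simp [h]
  have hmem4 : 4 ∈ {n | ∃ c ∈ (subfieldSubcode F (ntCode K 2 4 3 (fun i => ((e i : K × K))) 36) :
        Set (Fin 32 → F)), c ≠ 0 ∧ hammingWt c = n} := by
    have c0 : ((0 : K), (0 : K)) ∈ ntCurve K 2 4 3 := by rw [mem_curve]; simp [tr]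
    have c1 : ((0 : K), (1 : K)) ∈ ntCurve K 2 4 3 := by
      rw [mem_curve]; simp [tr]; linear_combination (-2 : K) * h2
    have c2 : ((0 : K), w) ∈ ntCurve K 2 4 3 := by
      rw [mem_curve]; simp [tr]
      linear_combination -(w + w ^ 5 + w ^ 2) * hw3' - (w + w ^ 2) * h2
    have c3 : ((0 : K), w ^ 2) ∈ ntCurve K 2 4 3 := by
      rw [mem_curve]; simp [tr]
      linear_combination -(w + (w ^ 5 + w ^ 2) + (w ^ 13 + w ^ 10 + w ^ 7 + w ^ 4 + w)) * hw3'
        - (w + w ^ 2) * h2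
    let T : Finset (Fin 32) := {e.symm ⟨_, c0⟩, e.symm ⟨_, c1⟩, e.symm ⟨_, c2⟩, e.symm ⟨_, c3⟩}
    have n0 : e.symm ⟨_, c0⟩ ∉
        ({e.symm ⟨_, c1⟩, e.symm ⟨_, c2⟩, e.symm ⟨_, c3⟩} : Finset (Fin 32)) := by
      simp [hw0.symm, hw4.symm]
    have n1 : e.symm ⟨_, c1⟩ ∉ ({e.symm ⟨_, c2⟩, e.symm ⟨_, c3⟩} : Finset (Fin 32)) := by
      simp [hw1.symm, hw3.symm]
    have n2 : e.symm ⟨_, c2⟩ ≠ e.symm ⟨_, c3⟩ := by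
      simpa using hw2
    have hT : T.card = 4 := by
      simp only [T]
      rw [Finset.card_insert_of_notMem n0, Finset.card_insert_of_notMem n1, Finset.card_pair n2]
    refine ⟨_, (hind T).2 ⟨?_, ?_, ?_⟩, ?_, (hwt T).trans hT⟩
    · rw [hT]; push_cast; linear_combination 2 * h2
    · simp only [T]
      rw [Finset.sum_insert n0, Finset.sum_insert n1, Finset.sum_pair n2]
      simp
    · simp only [T]
      rw [Finset.sum_insert n0, Finset.sum_insert n1, Finset.sum_pair n2]
      simp
      linear_combination hw
    · intro h
      have := congrFun h (e.symm ⟨_, c0⟩)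
      simp [T] at this
  unfold minWt
  apply le_antisymm (Nat.sInf_le hmem4)
  refine le_csInf ⟨4, hmem4⟩ ?_
  rintro n ⟨c, hc, hc0, rfl⟩
  obtain ⟨T, rfl⟩ := hrep c
  rw [hwt]
  obtain ⟨hcard, hx, hy⟩ := (hind T).1 hc
  by_contra hlt
  have hlt' : T.card < 4 := by omega
  have hcases : T.card = 0 ∨ T.card = 1 ∨ T.card = 2 ∨ T.card = 3 := by omega
  rcases hcases with h | h | h | h
  · apply hc0
    rw [Finset.card_eq_zero] at h
    funext i
    simp [h]
  · rw [h] at hcard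
    simp at hcard
  · obtain ⟨i, j, hij, rfl⟩ := Finset.card_eq_two.1 h
    rw [Finset.sum_pair hij] at hx hy
    apply hij
    apply e.injective
    apply Subtype.ext
    apply Prod.ext
    · linear_combination hx - (e j : K × K).1 * h2
    · linear_combination hy - (e j : K × K).2 * h2
  · rw [h] at hcard
    push_cast at hcard
    apply one_ne_zero (α := K)
    linear_combination hcard - h2

end NTAux

/-- For `q = 2`, `r = 4`, `u = 3`, the binary subfield subcode `NT_3(36)|F_2` of the
extended Norm--Trace code over `F_16` is a `[32, 25, 4]` binary linear code: it has
length `32`, `F_2`-dimension `25`, and minimum Hamming distance `4`. -/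
theorem subfieldSubcode_ntCode_three_thirtysix
    (K F : Type*) [Field K] [Fintype K] [Field F] [Fintype F] [Algebra F K]
    (hK : Fintype.card K = 16) (hF : Fintype.card F = 2)
    (e : Fin 32 ≃ ↥(ntCurve K 2 4 3)) :
    Module.finrank F (subfieldSubcode F (ntCode K 2 4 3 (fun i => ((e i : K × K))) 36)) = 25
    ∧ minWt ((subfieldSubcode F (ntCode K 2 4 3 (fun i => ((e i : K × K))) 36) :
        Set (Fin 32 → F))) = 4 := by
  exact ⟨NTAux.finrank_code hK hF e, NTAux.minWt_code hK hF e⟩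
end

section
/- For q = 2, r = 4, u = 3, every codeword of the binary subfield subcode NT_3(36)|F_2 of the extended Norm–Trace code over F_16 has even Hamming weight. -/
open scoped BigOperators

section Helpers
variable {K : Type*} [Field K] [Fintype K]

lemma aux_two (hK : Fintype.card K = 16) : (2 : K) = 0 := by
  have h := FiniteField.cast_card_eq_zero K
  rw [hK] at h
  have h2 : (2 : K) ^ 4 = 0 := by
    rw [← h]; norm_num
  exact pow_eq_zero_iff (by norm_num) |>.1 h2

lemma aux_sum (hK : Fintype.card K = 16) (n : ℕ) (hn : n < 15) : ∑ x : K, x ^ n = 0 :=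
  FiniteField.sum_pow_lt_card_sub_one K n (by omega)

open Classical in
/-- The indicator of the curve as a polynomial function. -/
lemma aux_ind (hK : Fintype.card K = 16) (x y : K) :
    (if x ^ 3 = ∑ i ∈ Finset.range 4, y ^ 2 ^ i then (1 : K) else 0) =
      (1 + x ^ 15) + (1 + x ^ 3 + x ^ 6 + x ^ 9 + x ^ 12) * (y + y ^ 2 + y ^ 4 + y ^ 8) := by
  have h2 := aux_two hK
  have hy : y ^ 16 = y := by rw [← hK]; exact FiniteField.pow_card y
  have hx : x ≠ 0 → x ^ 15 = 1 := fun h => by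
    have := FiniteField.pow_card_sub_one_eq_one x h
    rwa [hK] at this
  have hs : ∑ i ∈ Finset.range 4, y ^ 2 ^ i = y + y ^ 2 + y ^ 4 + y ^ 8 := by
    simp [Finset.sum_range_succ]
  rw [hs]
  have hT : (y + y ^ 2 + y ^ 4 + y ^ 8) * (y + y ^ 2 + y ^ 4 + y ^ 8 - 1) = 0 := by
    linear_combination hy +
      (y ^ 3 + y ^ 5 + y ^ 9 + y ^ 6 + y ^ 10 + y ^ 12) * h2
  generalize y + y ^ 2 + y ^ 4 + y ^ 8 = T at *
  rcases mul_eq_zero.1 hT with h | h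
  · subst h
    by_cases h0 : x = 0
    · simp [h0]
    · have := hx h0
      rw [if_neg (by simpa using h0), this]
      linear_combination -h2
  · have h1 : T = 1 := sub_eq_zero.1 h
    subst h1
    split_ifs with h3
    · linear_combination (-(x ^ 12 + 2 * x ^ 9 + 3 * x ^ 6 + 4 * x ^ 3 + 5)) * h3 - 3 * h2
    · by_cases h0 : x = 0
      · simp [h0]
        linear_combination -h2
      · have h15 := hx h0
        have : (x ^ 3 - 1) * (1 + x ^ 3 + x ^ 6 + x ^ 9 + x ^ 12) = 0 := by
          linear_combination h15
        have h5 := (mul_eq_zero.1 this).resolve_left (sub_ne_zero.2 h3)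
        linear_combination -h5 - h15 - h2

lemma aux_mono (hK : Fintype.card K = 16) (e : Fin 32 ≃ ↥(ntCurve K 2 4 3)) (a b : ℕ)
    (hab : 8 * a + 3 * b ≤ 36) :
    ∑ i, (e i : K × K).1 ^ a * (e i : K × K).2 ^ b = 0 := by
  classical
  have : Fintype ↥(ntCurve K 2 4 3) := Fintype.ofFinite _
  rw [Equiv.sum_comp e (fun P : ↥(ntCurve K 2 4 3) => (P : K × K).1 ^ a * (P : K × K).2 ^ b)]
  have h1 : ∑ P : ↥(ntCurve K 2 4 3), (P : K × K).1 ^ a * (P : K × K).2 ^ b =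
      ∑ P : K × K, (P.1 ^ a * P.2 ^ b) *
        (if P.1 ^ 3 = ∑ i ∈ Finset.range 4, P.2 ^ 2 ^ i then (1 : K) else 0) := by
    simp only [mul_ite, mul_one, mul_zero]
    rw [← Finset.sum_filter]
    symm
    apply Finset.sum_subtype
    intro P
    simp [ntCurve]
  rw [h1]
  simp only [aux_ind hK]
  rw [Fintype.sum_prod_type]
  have h2 : ∀ x y : K, (x ^ a * y ^ b) * ((1 + x ^ 15) +
      (1 + x ^ 3 + x ^ 6 + x ^ 9 + x ^ 12) * (y + y ^ 2 + y ^ 4 + y ^ 8)) =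
      (x ^ a * (1 + x ^ 15)) * y ^ b +
      (x ^ a + x ^ (a + 3) + x ^ (a + 6) + x ^ (a + 9) + x ^ (a + 12)) *
        (y ^ (b + 1) + y ^ (b + 2) + y ^ (b + 4) + y ^ (b + 8)) := by
    intro x y; ring
  simp only [h2, Finset.sum_add_distrib (f := fun y : K => _ * y ^ b)]
  rw [Finset.sum_add_distrib]
  simp only [← Finset.mul_sum, ← Finset.sum_mul]
  rw [aux_sum hK b (by omega), mul_zero, zero_add]
  by_cases hb : b ≤ 6
  · simp only [Finset.sum_add_distrib (ι := K)]
    rw [aux_sum hK (b + 1) (by omega), aux_sum hK (b + 2) (by omega),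
      aux_sum hK (b + 4) (by omega), aux_sum hK (b + 8) (by omega)]
    simp
  · simp only [Finset.sum_add_distrib (ι := K)]
    rw [aux_sum hK a (by omega), aux_sum hK (a + 3) (by omega), aux_sum hK (a + 6) (by omega),
      aux_sum hK (a + 9) (by omega), aux_sum hK (a + 12) (by omega)]
    simp

end Helpers

/-- For `q = 2`, `r = 4`, `u = 3`, every codeword of the binary subfield subcode
`NT_3(36)|F_2` of the extended Norm--Trace code over `F_16` has even Hamming weight. -/
theorem even_hammingWt_subfieldSubcode_ntCode_three_thirtysix
    (K F : Type*) [Field K] [Fintype K] [Field F] [Fintype F] [Algebra F K]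
    (hK : Fintype.card K = 16) (hF : Fintype.card F = 2)
    (e : Fin 32 ≃ ↥(ntCurve K 2 4 3)) :
    ∀ c ∈ subfieldSubcode F (ntCode K 2 4 3 (fun i => ((e i : K × K))) 36),
      Even (hammingWt c) := by
  classical
  intro c hc
  have hc' : (fun i => algebraMap F K (c i)) ∈ ntCode K 2 4 3 (fun i => ((e i : K × K))) 36 := hc
  have key : ∀ v ∈ ntCode K 2 4 3 (fun i => ((e i : K × K))) 36, ∑ i, v i = 0 := by
    intro v hv
    unfold ntCode at hv
    induction hv using Submodule.span_induction with
    | mem v hv =>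
      obtain ⟨a, b, hab, rfl⟩ := hv
      refine aux_mono hK e a b ?_
      norm_num at hab
      omega
    | zero => simp
    | add v w _ _ hv hw => simp [Finset.sum_add_distrib, hv, hw]
    | smul k v _ hv => simp [← Finset.mul_sum, hv]
  have h0 := key _ hc'
  rw [← map_sum] at h0
  have h1 : ∑ i, c i = 0 := (map_eq_zero _).1 h0
  have hone : ∀ x : F, x ≠ 0 → x = 1 := fun x hx => by
    have := FiniteField.pow_card_sub_one_eq_one x hx
    rw [hF] at this
    simpa using this
  have h2 : ∑ i, c i = ((Finset.univ.filter fun i => c i ≠ 0).card : F) := by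
    rw [Finset.card_filter, Nat.cast_sum]
    refine Finset.sum_congr rfl fun i _ => ?_
    by_cases h : c i = 0
    · simp [h]
    · simp [hone _ h]
  have h3 : hammingWt c = (Finset.univ.filter fun i => c i ≠ 0).card := by
    unfold hammingWt
    rw [← Set.ncard_coe_finset]
    simp
  rw [h3]
  rw [h2] at h1
  by_contra hodd
  obtain ⟨k, hk⟩ := Nat.not_even_iff_odd.1 hodd
  have hF2 : (2 : F) = 0 := by
    have h := FiniteField.cast_card_eq_zero F
    rw [hF] at h
    exact_mod_cast h
  rw [hk] at h1
  push_cast at h1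
  rw [hF2] at h1
  simp at h1
end
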